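/- (Stratification) Let A ⊆ ℝ^n be a semi-algebraic set. There exist an integer N, bounded in terms of deg(A) (and n), and connected Nash manifolds A₁,…,A_N such that A is the disjoint union of A₁,…,A_N and, for all j ≠ i, if A_i ∩ closure(A_j) ≠ ∅ then A_i ⊆ closure(A_j) and dim(A_i) < dim(A_j). -/

import Mathlib

open Set

noncomputable section

/-- The open unit cube `(0,1)^d`. -/
def cubeO (d : ℕ) : Set (Fin d → ℝ) := {x | ∀ i, x i ∈ Set.Ioo (0:ℝ) 1}

/-- The closed unit cube `[0,1]^d`. -/
def cubeC (d : ℕ) : Set (Fin d → ℝ) := {x | ∀ i, x i ∈ Set.Icc (0:ℝ) 1}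

/-- A presentation of a semi-algebraic set: a finite union (list) of conjunctions, each
given by a list of polynomials required to be `> 0` and a list required to be `= 0`. -/
abbrev SAPres (d : ℕ) :=
  List (List (MvPolynomial (Fin d) ℝ) × List (MvPolynomial (Fin d) ℝ))

/-- The set defined by a presentation. -/
def SAPres.toSet {d : ℕ} (p : SAPres d) : Set (Fin d → ℝ) :=
  {x | ∃ c ∈ p, (∀ P ∈ c.1, 0 < MvPolynomial.eval x P) ∧
                (∀ P ∈ c.2, MvPolynomial.eval x P = 0)}

/-- The degree of a presentation: the sum of the total degrees of the polynomials
involved (with multiplicities). -/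
def SAPres.deg {d : ℕ} (p : SAPres d) : ℕ :=
  (p.map fun c =>
    (c.1.map MvPolynomial.totalDegree).sum + (c.2.map MvPolynomial.totalDegree).sum).sum

/-- A set is semi-algebraic if it admits a presentation. -/
def IsSemialgebraic {d : ℕ} (A : Set (Fin d → ℝ)) : Prop := ∃ p : SAPres d, p.toSet = A

/-- The degree of a semi-algebraic set: the minimum degree of its presentations. -/
def SADeg {d : ℕ} (A : Set (Fin d → ℝ)) : ℕ :=
  sInf (SAPres.deg '' {p : SAPres d | p.toSet = A})

/-- The graph of `f : A → ℝ^n`, `A ⊆ ℝ^k`, as a subset of `ℝ^(k+n)`. -/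
def graphSet {k n : ℕ} (A : Set (Fin k → ℝ)) (f : (Fin k → ℝ) → (Fin n → ℝ)) :
    Set (Fin (k + n) → ℝ) :=
  {z | (fun i => z (Fin.castAdd n i)) ∈ A ∧
       (fun j => z (Fin.natAdd k j)) = f fun i => z (Fin.castAdd n i)}

/-- A map is semi-algebraic if its graph is a semi-algebraic set. -/
def IsSAMap {k n : ℕ} (A : Set (Fin k → ℝ)) (f : (Fin k → ℝ) → (Fin n → ℝ)) : Prop :=
  IsSemialgebraic (graphSet A f)

/-- The degree of a semi-algebraic map is the degree of its graph. -/
def SAMapDeg {k n : ℕ} (A : Set (Fin k → ℝ)) (f : (Fin k → ℝ) → (Fin n → ℝ)) : ℕ :=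
  SADeg (graphSet A f)

/-- Scalar-valued version of `IsSAMap`. -/
def IsSAFun {k : ℕ} (A : Set (Fin k → ℝ)) (f : (Fin k → ℝ) → ℝ) : Prop :=
  IsSAMap A fun x (_ : Fin 1) => f x

/-- Scalar-valued version of `SAMapDeg`. -/
def SAFunDeg {k : ℕ} (A : Set (Fin k → ℝ)) (f : (Fin k → ℝ) → ℝ) : ℕ :=
  SAMapDeg A fun x (_ : Fin 1) => f x

/-- `A ⊆ ℝ^d` is an `m`-dimensional analytic submanifold: around each of its points there is
an analytic chart of `ℝ^d` straightening `A` to a coordinate subspace of dimension `m`. -/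
def IsAnalyticSubmanifold {d : ℕ} (A : Set (Fin d → ℝ)) (m : ℕ) : Prop :=
  ∀ x ∈ A, ∃ (U V : Set (Fin d → ℝ)) (φ ψ : (Fin d → ℝ) → (Fin d → ℝ)),
    IsOpen U ∧ IsOpen V ∧ x ∈ U ∧
    AnalyticOnNhd ℝ φ U ∧ AnalyticOnNhd ℝ ψ V ∧
    (∀ y ∈ U, φ y ∈ V) ∧ (∀ z ∈ V, ψ z ∈ U) ∧
    (∀ y ∈ U, ψ (φ y) = y) ∧ (∀ z ∈ V, φ (ψ z) = z) ∧
    φ '' (U ∩ A) = V ∩ {z | ∀ i : Fin d, m ≤ (i : ℕ) → z i = 0}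

/-- A Nash manifold: an analytic submanifold of `ℝ^d` which is a semi-algebraic set. -/
def IsNashManifold {d : ℕ} (A : Set (Fin d → ℝ)) (m : ℕ) : Prop :=
  IsSemialgebraic A ∧ IsAnalyticSubmanifold A m

/-- A Nash map on `A`: a semi-algebraic map which is analytic on `A` (i.e. extends
analytically around every point of `A`). -/
def IsNashMap {k n : ℕ} (A : Set (Fin k → ℝ)) (f : (Fin k → ℝ) → (Fin n → ℝ)) : Prop :=
  IsSAMap A f ∧ ∀ x ∈ A, ∃ (U : Set (Fin k → ℝ)) (g : (Fin k → ℝ) → (Fin n → ℝ)),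
    IsOpen U ∧ x ∈ U ∧ AnalyticOnNhd ℝ g U ∧ Set.EqOn f g (A ∩ U)

/-- Scalar valued Nash map. -/
def IsNashFun {k : ℕ} (A : Set (Fin k → ℝ)) (f : (Fin k → ℝ) → ℝ) : Prop :=
  IsSAFun A f ∧ ∀ x ∈ A, ∃ (U : Set (Fin k → ℝ)) (g : (Fin k → ℝ) → ℝ),
    IsOpen U ∧ x ∈ U ∧ AnalyticOnNhd ℝ g U ∧ Set.EqOn f g (A ∩ U)

/-- The total degree `|α|` of a multi-index. -/
def mIdxDeg {d : ℕ} (α : Fin d → ℕ) : ℕ := ∑ i, α i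

/-- The total order `≼` on multi-indices: `α ≼ β` iff `|α| < |β|`, or `|α| = |β|` and
`α k ≤ β k` at the largest index `k` where they differ (reflexivity included). -/
def mIdxLE {d : ℕ} (α β : Fin d → ℕ) : Prop :=
  α = β ∨ mIdxDeg α < mIdxDeg β ∨
    (mIdxDeg α = mIdxDeg β ∧ ∃ k, α k < β k ∧ ∀ l, k < l → α l = β l)

/-- Pad a multi-index on `Fin l` to one on `Fin d` by zeros (in the last coordinates). -/
def padIdx {l d : ℕ} (β : Fin l → ℕ) : Fin d → ℕ :=
  fun i => if h : (i : ℕ) < l then β ⟨i, h⟩ else 0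

/-- First-order partial derivative in the `i`-th coordinate direction. -/
def pderiv1 {d : ℕ} (i : Fin d) (f : (Fin d → ℝ) → ℝ) : (Fin d → ℝ) → ℝ :=
  fun x => fderiv ℝ f x (Pi.single i 1)

/-- Iterated partial derivative `∂^β f` associated to a multi-index `β`. -/
def mpderiv {d : ℕ} (β : Fin d → ℕ) (f : (Fin d → ℝ) → ℝ) : (Fin d → ℝ) → ℝ :=
  (List.finRange d).foldl (fun g i => (pderiv1 i)^[β i] g) f

/-- A `C⁰`-Nash map `A → (0,1)^n`: a Nash map with values in the open unit cube which
extends continuously to the closure of `A`. -/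
def IsC0NashMap {k n : ℕ} (A : Set (Fin k → ℝ)) (f : (Fin k → ℝ) → (Fin n → ℝ)) : Prop :=
  IsNashMap A f ∧ (∀ x ∈ A, f x ∈ cubeO n) ∧
    ∃ g : (Fin k → ℝ) → (Fin n → ℝ), ContinuousOn g (closure A) ∧ Set.EqOn f g A

/-- Scalar version of `IsC0NashMap`, with values in `(0,1)`. -/
def IsC0NashFun {k : ℕ} (A : Set (Fin k → ℝ)) (f : (Fin k → ℝ) → ℝ) : Prop :=
  IsNashFun A f ∧ (∀ x ∈ A, f x ∈ Set.Ioo (0:ℝ) 1) ∧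
    ∃ g : (Fin k → ℝ) → ℝ, ContinuousOn g (closure A) ∧ Set.EqOn f g A

/-- The bound `‖f‖_α ≤ K`: all partial derivatives `∂^β f` with `β ≼ α` are bounded by `K`
on `A`.  (Multi-indices `β` on the domain are padded by zeros to be compared with `α`.) -/
def CalphaBound {k e : ℕ} (A : Set (Fin k → ℝ)) (α : Fin e → ℕ) (K : ℝ)
    (f : (Fin k → ℝ) → ℝ) : Prop :=
  ∀ β : Fin k → ℕ, mIdxLE (padIdx β) α → ∀ x ∈ A, |mpderiv β f x| ≤ K

/-- A `(C^α,K)`-Nash map: a `C⁰`-Nash map with `‖f‖_α ≤ K`. -/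
def IsCalphaNashMap {k n e : ℕ} (A : Set (Fin k → ℝ)) (α : Fin e → ℕ) (K : ℝ)
    (f : (Fin k → ℝ) → (Fin n → ℝ)) : Prop :=
  IsC0NashMap A f ∧ ∀ j : Fin n, CalphaBound A α K fun x => f x j

/-- Scalar version of `IsCalphaNashMap`. -/
def IsCalphaNashFun {k e : ℕ} (A : Set (Fin k → ℝ)) (α : Fin e → ℕ) (K : ℝ)
    (f : (Fin k → ℝ) → ℝ) : Prop :=
  IsC0NashFun A f ∧ CalphaBound A α K f

/-- A `(C^r,K)`-Nash map: a `C⁰`-Nash map all of whose partial derivatives of order `≤ r`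
are bounded by `K`. -/
def IsCrNashMap {k n : ℕ} (A : Set (Fin k → ℝ)) (r : ℕ) (K : ℝ)
    (f : (Fin k → ℝ) → (Fin n → ℝ)) : Prop :=
  IsC0NashMap A f ∧ ∀ (j : Fin n) (β : Fin k → ℕ), mIdxDeg β ≤ r →
    ∀ x ∈ A, |mpderiv β (fun y => f y j) x| ≤ K

/-- A triangular map `(0,1)^l → (0,1)^d`: the `(d-l+k)`-th coordinate depends only on the
variables `x_k, …, x_l` (stated here with `0`-based indices). -/
def IsTriangular {l d : ℕ} (ψ : (Fin l → ℝ) → (Fin d → ℝ)) : Prop :=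
  l ≤ d ∧ ∀ (j : Fin d) (x y : Fin l → ℝ),
    (∀ i : Fin l, (j : ℕ) ≤ (i : ℕ) + (d - l) → x i = y i) → ψ x j = ψ y j

/-- `A` has maximum dimension `l`: it admits a finite partition into connected Nash
manifolds of dimensions `≤ l`, with `l` attained. -/
def HasMaxDim {d : ℕ} (A : Set (Fin d → ℝ)) (l : ℕ) : Prop :=
  ∃ (N : ℕ) (S : Fin N → Set (Fin d → ℝ)) (m : Fin N → ℕ),
    (∀ i, IsNashManifold (S i) (m i)) ∧ (∀ i, IsConnected (S i)) ∧
    A = (⋃ i, S i) ∧ (∀ i j, i ≠ j → Disjoint (S i) (S j)) ∧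
    (∀ i, m i ≤ l) ∧ (∃ i, m i = l)

/-- A `(C^α,K)`-resolution, with all cardinality/degree bounds at most `B`, of a finite
family of maps `f j : A → (0,1)`, where `A ⊆ (0,1)^d` has maximum dimension `l`. -/
def HasFamilyResolution {d k : ℕ} (l : ℕ) (A : Set (Fin d → ℝ))
    (f : Fin k → (Fin d → ℝ) → ℝ) (α : Fin d → ℕ) (K B : ℝ) : Prop :=
  ∃ (N : ℕ) (φ : Fin N → (Fin l → ℝ) → (Fin d → ℝ)),
    (∀ i, IsTriangular (φ i)) ∧
    (∀ i, IsCalphaNashMap (cubeO l) α K (φ i)) ∧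
    (∀ i j, IsCalphaNashFun (cubeO l) α K fun x => f j (φ i x)) ∧
    closure A = (⋃ i, φ i '' cubeC l) ∧
    (N : ℝ) ≤ B ∧
    (∀ i, (SAMapDeg (cubeO l) (φ i) : ℝ) ≤ B) ∧
    (∀ i j, (SAFunDeg (cubeO l) (fun x => f j (φ i x)) : ℝ) ≤ B)

/-- The open slice `{(x₁,y) ∈ (0,1) × S : f y < x₁ < g y}` in `ℝ^(d+1)`. -/
def bandSlice {d : ℕ} (S : Set (Fin d → ℝ)) (f g : (Fin d → ℝ) → ℝ) :
    Set (Fin (d+1) → ℝ) :=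
  {z | z 0 ∈ Set.Ioo (0:ℝ) 1 ∧ Fin.tail z ∈ S ∧ f (Fin.tail z) < z 0 ∧ z 0 < g (Fin.tail z)}

/-- The graph slice `{(f y, y) : y ∈ S}` in `ℝ^(d+1)`. -/
def graphSlice {d : ℕ} (S : Set (Fin d → ℝ)) (f : (Fin d → ℝ) → ℝ) :
    Set (Fin (d+1) → ℝ) :=
  {z | Fin.tail z ∈ S ∧ z 0 = f (Fin.tail z)}

/-- The Euclidean distance from a point to a set. -/
def eDist {d : ℕ} (x : Fin d → ℝ) (S : Set (Fin d → ℝ)) : ℝ :=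
  sInf ((fun y => Real.sqrt (∑ i, (x i - y i) ^ 2)) '' S)

end

section SignDiagrams

open Polynomial

variable {R : Type*} [CommRing R]

theorem exists_pseudo_division (q : R[X]) (hq : 1 ≤ q.natDegree) (p : R[X]) :
    ∃ (r u : R[X]) (k : ℕ), C q.leadingCoeff ^ k * p = u * q + r ∧ r.natDegree < q.natDegree := by
  induction h : p.natDegree using Nat.strong_induction_on generalizing p with
  | _ n ih =>
    by_cases hlt : p.natDegree < q.natDegree
    · exact ⟨p, 0, 0, by simp, hlt⟩
    push Not at hlt
    set s := C q.leadingCoeff * p - C p.leadingCoeff * X ^ (p.natDegree - q.natDegree) * q with hs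
    have hsd : s.natDegree ≤ p.natDegree - 1 := by
      rw [natDegree_le_iff_coeff_eq_zero]
      intro N hN
      have hN' : p.natDegree ≤ N := by omega
      rw [hs, coeff_sub, coeff_C_mul, mul_assoc, coeff_C_mul, coeff_X_pow_mul',
        if_pos (by omega)]
      rcases hN'.eq_or_lt with h1 | h1
      · have : N - (p.natDegree - q.natDegree) = q.natDegree := by omega
        rw [this, ← h1, coeff_natDegree, coeff_natDegree, mul_comm, sub_self]
      · rw [coeff_eq_zero_of_natDegree_lt h1, coeff_eq_zero_of_natDegree_lt (by omega)]
        simp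
    obtain ⟨r, u, k, h1, h2⟩ := ih s.natDegree (by omega) s rfl
    refine ⟨r, u + C q.leadingCoeff ^ k * (C p.leadingCoeff *
      X ^ (p.natDegree - q.natDegree)), k + 1, ?_, h2⟩
    have : C q.leadingCoeff ^ k * (C q.leadingCoeff * p) =
      C q.leadingCoeff ^ k * s + C q.leadingCoeff ^ k * (C p.leadingCoeff *
      X ^ (p.natDegree - q.natDegree)) * q := by rw [hs]; ring
    rw [pow_succ, mul_assoc, this, h1]; ring

/-- A pseudo-remainder of `p` modulo `q`. -/
noncomputable def pseudoRem (p q : R[X]) : R[X] :=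
  open Classical in
  if hq : 1 ≤ q.natDegree then (exists_pseudo_division q hq p).choose else 0

theorem natDegree_pseudoRem_lt (p q : R[X]) (hq : 1 ≤ q.natDegree) :
    (pseudoRem p q).natDegree < q.natDegree := by
  rw [pseudoRem, dif_pos hq]
  exact (exists_pseudo_division q hq p).choose_spec.choose_spec.choose_spec.2

theorem eval₂_pseudoRem (p q : R[X]) (hq : 1 ≤ q.natDegree) : ∃ k : ℕ, ∀ (e : R →+* ℝ) (t : ℝ),
    q.eval₂ e t = 0 → e q.leadingCoeff ^ k * p.eval₂ e t = (pseudoRem p q).eval₂ e t := by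
  obtain ⟨k, h, -⟩ := (exists_pseudo_division q hq p).choose_spec.choose_spec
  refine ⟨k, fun e t ht => ?_⟩
  have := congrArg (Polynomial.eval₂ e t) h
  rw [pseudoRem, dif_pos hq]
  simpa [eval₂_mul, eval₂_pow, eval₂_add, ht] using this

theorem exists_closed_aux (F : Finset R[X]) (k : ℕ) (hF : ∀ p ∈ F, p.natDegree ≤ k) (i : ℕ) :
    ∃ G : Finset R[X], F ⊆ G ∧ (∀ p ∈ G, p.natDegree ≤ k) ∧
      (∀ p ∈ G, 1 ≤ p.natDegree → k < p.natDegree + i → p.eraseLead ∈ G ∧ derivative p ∈ G) ∧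
      (∀ p ∈ G, ∀ q ∈ G, 1 ≤ q.natDegree → k < q.natDegree + i → q.natDegree ≤ p.natDegree →
        pseudoRem p q ∈ G) := by
  classical
  induction i with
  | zero =>
    exact ⟨F, subset_rfl, hF, fun p hp _ h => absurd (hF p hp) (by omega),
      fun p _ q hq _ h => absurd (hF q hq) (by omega)⟩
  | succ i ih =>
    obtain ⟨G, hFG, hd, h1, h2⟩ := ih
    let B := G.filter fun q => 1 ≤ q.natDegree ∧ q.natDegree + i = k
    let N : Finset R[X] := B.image eraseLead ∪ B.image (fun q => derivative q) ∪
      (G ×ˢ B).image fun x => pseudoRem x.1 x.2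
    have hN : ∀ r ∈ N, r.natDegree + i < k := by
      intro r hr
      simp only [N, B, Finset.mem_union, Finset.mem_image, Finset.mem_filter, Finset.mem_product,
        Prod.exists] at hr
      rcases hr with (⟨q, ⟨-, hq, hqk⟩, rfl⟩ | ⟨q, ⟨-, hq, hqk⟩, rfl⟩) |
        ⟨p, q, ⟨-, -, hq, hqk⟩, rfl⟩
      · have := eraseLead_natDegree_le q; omega
      · have := natDegree_derivative_lt (p := q) (by omega); omega
      · have := natDegree_pseudoRem_lt p q hq; omega
    have key : ∀ p ∈ G ∪ N, k < p.natDegree + (i + 1) → p ∈ G ∧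
        (k < p.natDegree + i ∨ p.natDegree + i = k) := by
      intro p hp hk
      rcases Finset.mem_union.1 hp with h | h
      · exact ⟨h, by omega⟩
      · have := hN p h; omega
    refine ⟨G ∪ N, hFG.trans Finset.subset_union_left, ?_, ?_, ?_⟩
    · intro p hp
      rcases Finset.mem_union.1 hp with h | h
      · exact hd p h
      · have := hN p h; omega
    · intro p hp hp1 hk
      obtain ⟨hpG, h | h⟩ := key p hp hk
      · exact ⟨Finset.mem_union_left _ (h1 p hpG hp1 h).1,
          Finset.mem_union_left _ (h1 p hpG hp1 h).2⟩
      · have hB : p ∈ B := Finset.mem_filter.2 ⟨hpG, hp1, h⟩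
        constructor <;> apply Finset.mem_union_right
        · exact Finset.mem_union_left _ (Finset.mem_union_left _ (Finset.mem_image_of_mem _ hB))
        · exact Finset.mem_union_left _ (Finset.mem_union_right _
            (Finset.mem_image_of_mem (fun q : R[X] => derivative q) hB))
    · intro p hp q hq hq1 hk hqp
      obtain ⟨hpG, -⟩ := key p hp (by omega)
      obtain ⟨hqG, h | h⟩ := key q hq hk
      · exact Finset.mem_union_left _ (h2 p hpG q hqG hq1 h hqp)
      · refine Finset.mem_union_right _ (Finset.mem_union_right _ ?_)
        exact Finset.mem_image.2 ⟨(p, q), Finset.mem_product.2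
          ⟨hpG, Finset.mem_filter.2 ⟨hqG, hq1, h⟩⟩, rfl⟩

/-- Every finite set of polynomials is contained in a finite set closed under erasing leading
terms, taking derivatives and taking pseudo-remainders. -/
theorem exists_closed (F : Finset R[X]) :
    ∃ G : Finset R[X], F ⊆ G ∧
      (∀ p ∈ G, 1 ≤ p.natDegree → p.eraseLead ∈ G ∧ derivative p ∈ G) ∧
      (∀ p ∈ G, ∀ q ∈ G, 1 ≤ q.natDegree → q.natDegree ≤ p.natDegree → pseudoRem p q ∈ G) := by
  obtain ⟨G, h0, -, h1, h2⟩ := exists_closed_aux F (F.sup natDegree)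
    (fun p hp => Finset.le_sup (f := natDegree) hp) (F.sup natDegree)
  exact ⟨G, h0, fun p hp h => h1 p hp h (by omega), fun p hp q hq h => h2 p hp q hq h (by omega)⟩

/-- The polynomials in `L`, evaluated through `e` on `(a, b)` and through `e'` on `(a', b')`,
have the same sign diagram. -/
inductive SameDiagram (L : Finset R[X]) (e e' : R →+* ℝ) : ℝ → ℝ → ℝ → ℝ → Prop
  | base (a b a' b' : ℝ) (hab : a < b) (hab' : a' < b')
      (h : ∀ p ∈ L, ∀ t ∈ Ioo a b, ∀ t' ∈ Ioo a' b',
        SignType.sign (p.eval₂ e t) = SignType.sign (p.eval₂ e' t')) :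
      SameDiagram L e e' a b a' b'
  | split (a c b a' c' b' : ℝ) (hl : SameDiagram L e e' a c a' c')
      (hr : SameDiagram L e e' c b c' b') 
      (hc : ∀ p ∈ L, SignType.sign (p.eval₂ e c) = SignType.sign (p.eval₂ e' c'))
      (q : R[X]) (hq : q ∈ L) (hq0 : q.map e ≠ 0) (hqc : q.eval₂ e c = 0) :
      SameDiagram L e e' a b a' b'

variable {L : Finset R[X]} {e e' : R →+* ℝ} {a b a' b' : ℝ}

theorem SameDiagram.lt (h : SameDiagram L e e' a b a' b') : a < b ∧ a' < b' := by
  induction h with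
  | base _ _ _ _ h1 h2 => exact ⟨h1, h2⟩
  | split _ _ _ _ _ _ _ _ _ _ _ _ _ ih1 ih2 => exact ⟨ih1.1.trans ih2.1, ih1.2.trans ih2.2⟩

theorem SameDiagram.exists_eq (h : SameDiagram L e e' a b a' b') (t : ℝ) (ht : t ∈ Ioo a b) :
    ∃ t', ∀ p ∈ L, SignType.sign (p.eval₂ e t) = SignType.sign (p.eval₂ e' t') := by
  induction h with
  | base a b a' b' h1 h2 h =>
    exact ⟨(a' + b') / 2, fun p hp => h p hp t ht _ ⟨by linarith, by linarith⟩⟩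
  | split a c b a' c' b' _ _ hc _ _ _ _ ih1 ih2 =>
    rcases lt_trichotomy t c with h | h | h
    · exact ih1 ⟨ht.1, h⟩
    · exact ⟨c', h ▸ hc⟩
    · exact ih2 ⟨h, ht.2⟩

theorem SameDiagram.insert_base [DecidableEq R[X]] {p : R[X]} (hab : a < b) (hab' : a' < b')
    (h : ∀ q ∈ L, ∀ t ∈ Ioo a b, ∀ t' ∈ Ioo a' b',
        SignType.sign (q.eval₂ e t) = SignType.sign (q.eval₂ e' t'))
    (hp : ∃ s : SignType, (∀ t ∈ Ioo a b, SignType.sign (p.eval₂ e t) = s) ∧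
      ∀ t ∈ Ioo a' b', SignType.sign (p.eval₂ e' t) = s) :
    SameDiagram (insert p L) e e' a b a' b' := by
  obtain ⟨s, h1, h2⟩ := hp
  refine .base _ _ _ _ hab hab' fun q hq t ht t' ht' => ?_
  rcases Finset.mem_insert.1 hq with rfl | hq
  · rw [h1 t ht, h2 t' ht']
  · exact h q hq t ht t' ht'

theorem exists_zero_of_strictMonoOn {f : ℝ → ℝ} (hf : Continuous f)
    (hab : a < b) (ha : f a < 0) (hb : 0 < f b) : ∃ c ∈ Ioo a b, f c = 0 :=
  intermediate_value_Ioo hab.le hf.continuousOn ⟨ha, hb⟩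

/-- A common zero pattern for two strictly monotone functions. -/
theorem strictMonoOn_diagram {f f' : ℝ → ℝ} (hf : Continuous f) (hf' : Continuous f')
    (hab : a < b) (hab' : a' < b')
    (hm : StrictMonoOn f (Icc a b)) (hm' : StrictMonoOn f' (Icc a' b'))
    (ha : SignType.sign (f a) = SignType.sign (f' a'))
    (hb : SignType.sign (f b) = SignType.sign (f' b')) :
    (∃ s : SignType, (∀ t ∈ Ioo a b, SignType.sign (f t) = s) ∧
      ∀ t ∈ Ioo a' b', SignType.sign (f' t) = s) ∨
    (∃ c ∈ Ioo a b, ∃ c' ∈ Ioo a' b', f c = 0 ∧ f' c' = 0 ∧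
      (∀ t ∈ Ioo a c, SignType.sign (f t) = -1) ∧ (∀ t ∈ Ioo a' c', SignType.sign (f' t) = -1) ∧
      (∀ t ∈ Ioo c b, SignType.sign (f t) = 1) ∧ (∀ t ∈ Ioo c' b', SignType.sign (f' t) = 1)) := by
  by_cases h0 : 0 ≤ f a
  · have h0' : 0 ≤ f' a' := by rw [← sign_nonneg_iff] at h0 ⊢; rwa [← ha]
    refine .inl ⟨1, fun t ht => sign_pos ?_, fun t ht => sign_pos ?_⟩
    · exact h0.trans_lt (hm (left_mem_Icc.2 hab.le) (Ioo_subset_Icc_self ht) ht.1)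
    · exact h0'.trans_lt (hm' (left_mem_Icc.2 hab'.le) (Ioo_subset_Icc_self ht) ht.1)
  by_cases h1 : f b ≤ 0
  · have h1' : f' b' ≤ 0 := by rw [← sign_nonpos_iff] at h1 ⊢; rwa [← hb]
    refine .inl ⟨-1, fun t ht => sign_neg ?_, fun t ht => sign_neg ?_⟩
    · exact (hm (Ioo_subset_Icc_self ht) (right_mem_Icc.2 hab.le) ht.2).trans_le h1
    · exact (hm' (Ioo_subset_Icc_self ht) (right_mem_Icc.2 hab'.le) ht.2).trans_le h1'
  push Not at h0 h1
  have h0' : f' a' < 0 := by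
    rw [← sign_eq_neg_one_iff] at h0 ⊢; rwa [← ha]
  have h1' : 0 < f' b' := by
    rw [← sign_eq_one_iff] at h1 ⊢; rwa [← hb]
  obtain ⟨c, hc, hfc⟩ := exists_zero_of_strictMonoOn hf hab h0 h1
  obtain ⟨c', hc', hfc'⟩ := exists_zero_of_strictMonoOn hf' hab' h0' h1'
  have hcI := Ioo_subset_Icc_self hc
  have hcI' := Ioo_subset_Icc_self hc'
  refine .inr ⟨c, hc, c', hc', hfc, hfc', fun t ht => sign_neg ?_, fun t ht => sign_neg ?_,
    fun t ht => sign_pos ?_, fun t ht => sign_pos ?_⟩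
  · rw [← hfc]; exact hm ⟨ht.1.le, ht.2.le.trans hc.2.le⟩ hcI ht.2
  · rw [← hfc']; exact hm' ⟨ht.1.le, ht.2.le.trans hc'.2.le⟩ hcI' ht.2
  · rw [← hfc]; exact hm hcI ⟨hc.1.le.trans ht.1.le, ht.2.le⟩ ht.1
  · rw [← hfc']; exact hm' hcI' ⟨hc'.1.le.trans ht.1.le, ht.2.le⟩ ht.1

theorem hasDerivAt_eval₂ (p : R[X]) (e : R →+* ℝ) (t : ℝ) :
    HasDerivAt (fun t => p.eval₂ e t) ((derivative p).eval₂ e t) t := by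
  simp only [eval₂_eq_eval_map, ← derivative_map]
  exact (p.map e).hasDerivAt t

theorem continuous_eval₂ (p : R[X]) (e : R →+* ℝ) : Continuous fun t => p.eval₂ e t :=
  continuous_iff_continuousAt.2 fun t => (hasDerivAt_eval₂ p e t).continuousAt

theorem strictMonoOn_eval₂ {p : R[X]} {e : R →+* ℝ}
    (h : ∀ t ∈ Ioo a b, 0 < (derivative p).eval₂ e t) :
    StrictMonoOn (fun t => p.eval₂ e t) (Icc a b) :=
  strictMonoOn_of_deriv_pos (convex_Icc a b) (continuous_eval₂ p e).continuousOn fun t ht => by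
    rw [(hasDerivAt_eval₂ p e t).deriv]
    exact h t (by simpa using ht)

theorem strictMonoOn_neg_eval₂ {p : R[X]} {e : R →+* ℝ}
    (h : ∀ t ∈ Ioo a b, (derivative p).eval₂ e t < 0) :
    StrictMonoOn (fun t => -p.eval₂ e t) (Icc a b) :=
  (strictAntiOn_of_deriv_neg (convex_Icc a b) (continuous_eval₂ p e).continuousOn fun t ht => by
    rw [(hasDerivAt_eval₂ p e t).deriv]
    exact h t (by simpa using ht)).neg

theorem eval₂_eq_of_derivative_zero {p : R[X]} {e : R →+* ℝ} (hab : a < b)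
    (h : ∀ t ∈ Ioo a b, (derivative p).eval₂ e t = 0) (t s : ℝ) : p.eval₂ e t = p.eval₂ e s := by
  have h0 : derivative (p.map e) = 0 := by
    refine eq_zero_of_infinite_isRoot _ ((Ioo_infinite hab).mono fun t ht => ?_)
    rw [Set.mem_ofPred_eq, IsRoot, derivative_map, ← eval₂_eq_eval_map]
    exact h t ht
  rw [eval₂_eq_eval_map, eval₂_eq_eval_map,
    eq_C_of_natDegree_eq_zero (derivative_eq_zero.1 h0)]
  simp

/-- Adding a polynomial whose derivative is already in the family. -/
theorem SameDiagram.insert [DecidableEq R[X]] {p : R[X]} (h : SameDiagram L e e' a b a' b')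
    (hp0 : p.map e ≠ 0) (hd : derivative p ∈ L)
    (hz : ∀ c c', (∀ q ∈ L, SignType.sign (q.eval₂ e c) = SignType.sign (q.eval₂ e' c')) →
      ∀ q ∈ L, q.map e ≠ 0 → q.eval₂ e c = 0 →
      SignType.sign (p.eval₂ e c) = SignType.sign (p.eval₂ e' c'))
    (ha : SignType.sign (p.eval₂ e a) = SignType.sign (p.eval₂ e' a'))
    (hb : SignType.sign (p.eval₂ e b) = SignType.sign (p.eval₂ e' b')) :
    SameDiagram (insert p L) e e' a b a' b' := by
  induction h with
  | split a c b a' c' b' _ _ hc q hq hq0 hqc ih1 ih2 =>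
    have hpc := hz c c' hc q hq hq0 hqc
    refine .split a c b a' c' b' (ih1 ha hpc) (ih2 hpc hb) ?_ q (Finset.mem_insert_of_mem hq)
      hq0 hqc
    intro r hr
    rcases Finset.mem_insert.1 hr with rfl | hr
    · exact hpc
    · exact hc r hr
  | base a b a' b' hab hab' h =>
    have hmid : (a + b) / 2 ∈ Ioo a b := ⟨by linarith, by linarith⟩
    have hmid' : (a' + b') / 2 ∈ Ioo a' b' := ⟨by linarith, by linarith⟩
    have hdd := h _ hd
    have split_at : ∀ c ∈ Ioo a b, ∀ c' ∈ Ioo a' b', p.eval₂ e c = 0 → p.eval₂ e' c' = 0 →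
        (∃ s : SignType, (∀ t ∈ Ioo a c, SignType.sign (p.eval₂ e t) = s) ∧
          ∀ t ∈ Ioo a' c', SignType.sign (p.eval₂ e' t) = s) →
        (∃ s : SignType, (∀ t ∈ Ioo c b, SignType.sign (p.eval₂ e t) = s) ∧
          ∀ t ∈ Ioo c' b', SignType.sign (p.eval₂ e' t) = s) →
        SameDiagram (Insert.insert p L) e e' a b a' b' := by
      intro c hc c' hc' hpc hpc' h1 h2
      refine .split a c b a' c' b' ?_ ?_ ?_ p (Finset.mem_insert_self _ _) hp0 hpc
      · exact insert_base hc.1 hc'.1 (fun q hq t ht t' ht' => h q hq t ⟨ht.1, ht.2.trans hc.2⟩ t'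
          ⟨ht'.1, ht'.2.trans hc'.2⟩) h1
      · exact insert_base hc.2 hc'.2 (fun q hq t ht t' ht' => h q hq t ⟨hc.1.trans ht.1, ht.2⟩ t'
          ⟨hc'.1.trans ht'.1, ht'.2⟩) h2
      · intro r hr
        rcases Finset.mem_insert.1 hr with rfl | hr
        · rw [hpc, hpc']
        · exact h r hr c hc c' hc'
    rcases lt_trichotomy 0 ((derivative p).eval₂ e ((a + b) / 2)) with hs | hs | hs
    · have hs' : ∀ t ∈ Ioo a' b', 0 < (derivative p).eval₂ e' t := fun t ht => by
        rw [← sign_eq_one_iff, ← hdd _ hmid _ ht, sign_eq_one_iff]; exact hs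
      have hs : ∀ t ∈ Ioo a b, 0 < (derivative p).eval₂ e t := fun t ht => by
        rw [← sign_eq_one_iff, hdd _ ht _ hmid', sign_eq_one_iff]; exact hs' _ hmid'
      rcases strictMonoOn_diagram (continuous_eval₂ p e) (continuous_eval₂ p e') hab hab'
        (strictMonoOn_eval₂ hs) (strictMonoOn_eval₂ hs') ha hb with h1 |
        ⟨c, hc, c', hc', h1, h1', h2, h2', h3, h3'⟩
      · exact insert_base hab hab' h h1
      · exact split_at c hc c' hc' h1 h1' ⟨_, h2, h2'⟩ ⟨_, h3, h3'⟩
    · have hs' : ∀ t ∈ Ioo a' b', (derivative p).eval₂ e' t = 0 := fun t ht => by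
        rw [← sign_eq_zero_iff, ← hdd _ hmid _ ht, sign_eq_zero_iff]; exact hs.symm
      have hs : ∀ t ∈ Ioo a b, (derivative p).eval₂ e t = 0 := fun t ht => by
        rw [← sign_eq_zero_iff, hdd _ ht _ hmid', sign_eq_zero_iff]; exact hs' _ hmid'
      refine insert_base hab hab' h ⟨SignType.sign (p.eval₂ e a), fun t _ => ?_, fun t _ => ?_⟩
      · rw [eval₂_eq_of_derivative_zero hab hs t a]
      · rw [ha, eval₂_eq_of_derivative_zero hab' hs' t a']
    · have hs' : ∀ t ∈ Ioo a' b', (derivative p).eval₂ e' t < 0 := fun t ht => by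
        rw [← sign_eq_neg_one_iff, ← hdd _ hmid _ ht, sign_eq_neg_one_iff]; exact hs
      have hs : ∀ t ∈ Ioo a b, (derivative p).eval₂ e t < 0 := fun t ht => by
        rw [← sign_eq_neg_one_iff, hdd _ ht _ hmid', sign_eq_neg_one_iff]; exact hs' _ hmid'
      have flip : ∀ {x : ℝ} {s : SignType}, SignType.sign (-x) = s → SignType.sign x = -s := by
        rintro x s rfl; rw [Left.sign_neg, neg_neg]
      rcases strictMonoOn_diagram (continuous_eval₂ p e).neg (continuous_eval₂ p e').neg hab hab'
        (strictMonoOn_neg_eval₂ hs) (strictMonoOn_neg_eval₂ hs') (by simp [Left.sign_neg, ha])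
        (by simp [Left.sign_neg, hb]) with ⟨s, h1, h2⟩ |
        ⟨c, hc, c', hc', h1, h1', h2, h2', h3, h3'⟩
      · exact insert_base hab hab' h ⟨-s, fun t ht => flip (h1 t ht), fun t ht => flip (h2 t ht)⟩
      · exact split_at c hc c' hc' (neg_eq_zero.1 h1) (neg_eq_zero.1 h1')
          ⟨_, fun t ht => flip (h2 t ht), fun t ht => flip (h2' t ht)⟩
          ⟨_, fun t ht => flip (h3 t ht), fun t ht => flip (h3' t ht)⟩

theorem SameDiagram.insert_of_sign_eq [DecidableEq R[X]] {p : R[X]}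
    (h : SameDiagram L e e' a b a' b')
    (hp : ∀ c c', (∀ q ∈ L, SignType.sign (q.eval₂ e c) = SignType.sign (q.eval₂ e' c')) →
      SignType.sign (p.eval₂ e c) = SignType.sign (p.eval₂ e' c')) :
    SameDiagram (Insert.insert p L) e e' a b a' b' := by
  induction h with
  | split a c b a' c' b' _ _ hc q hq hq0 hqc ih1 ih2 =>
    refine .split a c b a' c' b' ih1 ih2 ?_ q (Finset.mem_insert_of_mem hq) hq0 hqc
    intro r hr
    rcases Finset.mem_insert.1 hr with rfl | hr
    · exact hp _ _ hc
    · exact hc r hr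
  | base a b a' b' hab hab' h =>
    refine .base a b a' b' hab hab' fun r hr t ht t' ht' => ?_
    rcases Finset.mem_insert.1 hr with rfl | hr
    · exact hp _ _ fun q hq => h q hq t ht t' ht'
    · exact h r hr t ht t' ht'

theorem eval₂_eraseLead {p : R[X]} {e : R →+* ℝ} (h : e p.leadingCoeff = 0) :
    p.eraseLead.map e = p.map e := by
  have := congrArg (Polynomial.map e) (eraseLead_add_C_mul_X_pow p)
  rwa [Polynomial.map_add, Polynomial.map_mul, map_C, h, C_0, zero_mul, add_zero] at this

theorem eventually_sign_atTop (p : ℝ[X]) :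
    ∀ᶠ t in Filter.atTop, SignType.sign (p.eval t) = SignType.sign p.leadingCoeff := by
  by_cases hd : 0 < p.degree
  · rcases lt_trichotomy 0 p.leadingCoeff with h | h | h
    · filter_upwards [(p.tendsto_atTop_of_leadingCoeff_nonneg hd h.le).eventually_gt_atTop 0]
        with t ht
      rw [sign_pos ht, sign_pos h]
    · rw [leadingCoeff_eq_zero.1 h.symm]; simp
    · filter_upwards [(p.tendsto_atBot_of_leadingCoeff_nonpos hd h.le).eventually_lt_atBot 0]
        with t ht
      rw [sign_neg ht, sign_neg h]
  · rw [eq_C_of_degree_le_zero (not_lt.1 hd)]; simp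

theorem eventually_sign_neg_atTop (p : ℝ[X]) :
    ∀ᶠ t in Filter.atTop, SignType.sign (p.eval (-t)) =
      SignType.sign (p.leadingCoeff * (-1) ^ p.natDegree) := by
  have := eventually_sign_atTop (p.comp (-X))
  rw [leadingCoeff_comp (by simp)] at this
  simpa using this

/-- The polynomial `p` has matching signs at `±t` for `e` and `e'`, when `t` is large. -/
theorem eventually_sign_eq {G : Finset R[X]}
    (hG : ∀ p ∈ G, 1 ≤ p.natDegree → p.eraseLead ∈ G)
    (hl : ∀ p ∈ G, SignType.sign (e p.leadingCoeff) = SignType.sign (e' p.leadingCoeff)) (p : R[X])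
    (hp : p ∈ G) : ∀ᶠ t in Filter.atTop,
      SignType.sign (p.eval₂ e t) = SignType.sign (p.eval₂ e' t) ∧
      SignType.sign (p.eval₂ e (-t)) = SignType.sign (p.eval₂ e' (-t)) := by
  induction h : p.natDegree using Nat.strong_induction_on generalizing p with
  | _ n ih =>
    by_cases hn : 1 ≤ p.natDegree
    · by_cases h0 : e p.leadingCoeff = 0
      · have h0' : e' p.leadingCoeff = 0 := by
          rw [← sign_eq_zero_iff, ← hl p hp, h0, sign_zero]
        have := ih p.eraseLead.natDegree
          (by have := eraseLead_natDegree_le p; omega) _ (hG p hp hn) rfl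
        simpa only [eval₂_eq_eval_map, eval₂_eraseLead h0, eval₂_eraseLead h0'] using this
      · have h0' : e' p.leadingCoeff ≠ 0 := by
          rw [← sign_ne_zero, ← hl p hp, sign_ne_zero]; exact h0
        filter_upwards [eventually_sign_atTop (p.map e), eventually_sign_atTop (p.map e'),
          eventually_sign_neg_atTop (p.map e), eventually_sign_neg_atTop (p.map e')]
          with t h1 h2 h3 h4
        rw [eval₂_eq_eval_map, eval₂_eq_eval_map, eval₂_eq_eval_map, eval₂_eq_eval_map,
          h1, h2, h3, h4, leadingCoeff_map_of_leadingCoeff_ne_zero _ h0,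
          leadingCoeff_map_of_leadingCoeff_ne_zero _ h0',
          natDegree_map_of_leadingCoeff_ne_zero _ h0,
          natDegree_map_of_leadingCoeff_ne_zero _ h0', sign_mul, sign_mul, hl p hp]
        exact ⟨rfl, rfl⟩
    · have h1 := hl p hp
      have h2 := eq_C_of_natDegree_eq_zero (p := p) (by omega)
      rw [h2, leadingCoeff_C] at h1
      rw [h2]
      exact Filter.Eventually.of_forall fun _ => by simpa using h1

/-- Sign agreement for `p` at the roots of polynomials of the family. -/
theorem sign_eq_of_root {L : Finset R[X]} {p : R[X]}
    (hG : ∀ q ∈ L, 1 ≤ q.natDegree → q.eraseLead ∈ L)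
    (hl : ∀ q ∈ L, SignType.sign (e q.leadingCoeff) = SignType.sign (e' q.leadingCoeff))
    (hr : ∀ q ∈ L, 1 ≤ q.natDegree → pseudoRem p q ∈ L) {c c' : ℝ}
    (hc : ∀ q ∈ L, SignType.sign (q.eval₂ e c) = SignType.sign (q.eval₂ e' c'))
    (q : R[X]) (hq : q ∈ L) (hq0 : q.map e ≠ 0) (hqc : q.eval₂ e c = 0) :
    SignType.sign (p.eval₂ e c) = SignType.sign (p.eval₂ e' c') := by
  induction h : q.natDegree using Nat.strong_induction_on generalizing q with
  | _ n ih =>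
    by_cases hn : 1 ≤ q.natDegree
    · by_cases h0 : e q.leadingCoeff = 0
      · refine ih q.eraseLead.natDegree
          (by have := eraseLead_natDegree_le q; omega) _ (hG q hq hn) ?_ ?_ rfl
        · rwa [eval₂_eraseLead h0]
        · rwa [eval₂_eq_eval_map, eval₂_eraseLead h0, ← eval₂_eq_eval_map]
      · obtain ⟨k, hk⟩ := eval₂_pseudoRem p q hn
        have h1 := hk e c hqc
        have h2 := hk e' c' (by rw [← sign_eq_zero_iff, ← hc q hq, hqc, sign_zero])
        have h3 := hc _ (hr q hq hn)
        rw [← h1, ← h2, sign_mul, sign_mul, sign_pow, sign_pow, ← hl q hq] at h3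
        exact mul_left_cancel₀ (pow_ne_zero _ (sign_ne_zero.2 h0)) h3
    · have h2 := eq_C_of_natDegree_eq_zero (p := q) (by omega)
      rw [h2] at hqc hq0
      simp at hqc hq0
      exact absurd hqc hq0

theorem sameDiagram_of_closed {G : Finset R[X]}
    (h1 : ∀ p ∈ G, 1 ≤ p.natDegree → p.eraseLead ∈ G ∧ derivative p ∈ G)
    (h2 : ∀ p ∈ G, ∀ q ∈ G, 1 ≤ q.natDegree → q.natDegree ≤ p.natDegree → pseudoRem p q ∈ G)
    (hl : ∀ p ∈ G, SignType.sign (e p.leadingCoeff) = SignType.sign (e' p.leadingCoeff))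
    (hab : a < b) (hab' : a' < b')
    (ha : ∀ p ∈ G, SignType.sign (p.eval₂ e a) = SignType.sign (p.eval₂ e' a'))
    (hb : ∀ p ∈ G, SignType.sign (p.eval₂ e b) = SignType.sign (p.eval₂ e' b')) :
    SameDiagram G e e' a b a' b' := by
  classical
  suffices H : ∀ L : Finset R[X], L ⊆ G →
      (∀ p ∈ L, ∀ q ∈ G, q.natDegree < p.natDegree → q ∈ L) → SameDiagram L e e' a b a' b' from
    H G subset_rfl fun _ _ q hq _ => hq
  intro L
  refine Finset.induction_on_max_value natDegree L ?_ ?_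
  · exact fun _ _ => .base _ _ _ _ hab hab' (by simp)
  · intro p L hpL hmax ih hLG hlow
    have hpG : p ∈ G := hLG (Finset.mem_insert_self _ _)
    have hLG' : ∀ q ∈ L, q ∈ G := fun q hq => hLG (Finset.mem_insert_of_mem hq)
    have hlow' : ∀ q ∈ G, q.natDegree < p.natDegree → q ∈ L := fun q hq hqp => by
      have := hlow p (Finset.mem_insert_self _ _) q hq hqp
      rcases Finset.mem_insert.1 this with rfl | h
      · omega
      · exact h
    have hL : ∀ q ∈ L, 1 ≤ q.natDegree → q.eraseLead ∈ L := fun q hq hq1 =>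
      hlow' _ (h1 q (hLG' q hq) hq1).1 (by have := eraseLead_natDegree_le q; have := hmax q hq; omega)
    have hS := ih hLG' fun r hr q hq hqr => hlow' q hq (hqr.trans_le (hmax r hr))
    by_cases hp1 : 1 ≤ p.natDegree
    · by_cases hp0 : p.map e = 0
      · have hlz : e p.leadingCoeff = 0 := by
          rw [leadingCoeff, ← coeff_map, hp0, coeff_zero]
        have hlz' : e' p.leadingCoeff = 0 := by
          rw [← sign_eq_zero_iff, ← hl p hpG, hlz, sign_zero]
        refine hS.insert_of_sign_eq fun c c' hc => ?_
        rw [eval₂_eq_eval_map, eval₂_eq_eval_map, ← eval₂_eraseLead hlz, ← eval₂_eraseLead hlz',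
          ← eval₂_eq_eval_map, ← eval₂_eq_eval_map]
        exact hc _ (hlow' _ (h1 p hpG hp1).1 (by have := eraseLead_natDegree_le p; omega))
      · refine hS.insert hp0 (hlow' _ (h1 p hpG hp1).2 (natDegree_derivative_lt (by omega))) ?_
          (ha p hpG) (hb p hpG)
        intro c c' hc q hq hq0 hqc
        refine sign_eq_of_root hL (fun q hq => hl q (hLG' q hq)) ?_ hc q hq hq0 hqc
        intro q hq hq1
        exact hlow' _ (h2 p hpG q (hLG' q hq) hq1 (hmax q hq))
          ((natDegree_pseudoRem_lt p q hq1).trans_le (hmax q hq))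
    · refine hS.insert_of_sign_eq fun c c' hc => ?_
      have h3 := hl p hpG
      have h4 := eq_C_of_natDegree_eq_zero (p := p) (by omega)
      rw [h4, leadingCoeff_C] at h3
      rw [h4]
      simpa using h3

/-- Elimination of one variable: the sign vectors realized by a finite family of univariate
polynomials only depend on the signs of finitely many elements of the coefficient ring. -/
theorem exists_finset_sign_determined (F : Finset R[X]) :
    ∃ H : Finset R, ∀ e e' : R →+* ℝ,
      (∀ h ∈ H, SignType.sign (e h) = SignType.sign (e' h)) →
      ∀ t, ∃ t', ∀ p ∈ F, SignType.sign (p.eval₂ e t) = SignType.sign (p.eval₂ e' t') := by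
  classical
  obtain ⟨G, hFG, h1, h2⟩ := exists_closed F
  refine ⟨G.image leadingCoeff, fun e e' hH t => ?_⟩
  have hl : ∀ p ∈ G, SignType.sign (e p.leadingCoeff) = SignType.sign (e' p.leadingCoeff) :=
    fun p hp => hH _ (Finset.mem_image_of_mem _ hp)
  have hev := (Filter.eventually_all_finset G).2
    (eventually_sign_eq (e := e) (e' := e') (fun p hp h => (h1 p hp h).1) hl)
  obtain ⟨M, hM, hM1⟩ := (hev.and (Filter.eventually_gt_atTop |t|)).exists
  have hM0 : -M < M := by linarith [abs_nonneg t]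
  obtain ⟨t', ht'⟩ := (sameDiagram_of_closed h1 h2 hl hM0 hM0 (fun p hp => (hM p hp).2)
    fun p hp => (hM p hp).1).exists_eq t (abs_lt.1 hM1)
  exact ⟨t', fun p hp => ht' p (hFG hp)⟩

end SignDiagrams

section UniformBounds

open Polynomial

theorem totalDegree_aeval_le {σ τ : Type*} (f : MvPolynomial σ ℝ) (c : σ → MvPolynomial τ ℝ)
    {d : ℕ} (hc : ∀ i, (c i).totalDegree ≤ d) :
    (MvPolynomial.aeval c f).totalDegree ≤ f.totalDegree * d := by
  rw [MvPolynomial.aeval_def, MvPolynomial.eval₂_eq]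
  refine MvPolynomial.totalDegree_finsetSum_le fun m hm => ?_
  refine (MvPolynomial.totalDegree_mul _ _).trans ?_
  rw [MvPolynomial.algebraMap_eq, MvPolynomial.totalDegree_C, zero_add]
  refine (MvPolynomial.totalDegree_finsetProd _ _).trans ?_
  refine le_trans (Finset.sum_le_sum fun i _ => (MvPolynomial.totalDegree_pow _ _).trans
    (Nat.mul_le_mul_left _ (hc i))) ?_
  rw [← Finset.sum_mul]
  exact Nat.mul_le_mul_right _ (MvPolynomial.le_totalDegree hm)

/-- The polynomial of degree `≤ d` in one variable with indeterminate coefficients. -/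
noncomputable def genericPoly (s d : ℕ) (j : Fin s) : (MvPolynomial (Fin s × ℕ) ℝ)[X] :=
  ∑ k ∈ Finset.range (d + 1), C (MvPolynomial.X (j, k)) * X ^ k

theorem eval₂_genericPoly {s d n : ℕ} (P : Fin s → (MvPolynomial (Fin n) ℝ)[X])
    (hP : ∀ j, (P j).natDegree ≤ d) (x : Fin n → ℝ) (t : ℝ) (j : Fin s) :
    (genericPoly s d j).eval₂ ((MvPolynomial.eval x).comp
      (MvPolynomial.aeval fun jk : Fin s × ℕ => (P jk.1).coeff jk.2).toRingHom) t =
      (P j).eval₂ (MvPolynomial.eval x) t := by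
  rw [genericPoly, eval₂_finsetSum, eval₂_eq_sum_range' _ (Nat.lt_succ_of_le (hP j))]
  refine Finset.sum_congr rfl fun k _ => ?_
  simp

theorem exists_uniform_sign_determined_fin (s d : ℕ) :
    ∃ K D : ℕ, ∀ (n : ℕ) (P : Fin s → (MvPolynomial (Fin n) ℝ)[X]), (∀ j, (P j).natDegree ≤ d) →
      (∀ j k, ((P j).coeff k).totalDegree ≤ d) →
      ∃ H : Finset (MvPolynomial (Fin n) ℝ), H.card ≤ K ∧ (∀ h ∈ H, h.totalDegree ≤ D) ∧
        ∀ x y, (∀ h ∈ H, SignType.sign (MvPolynomial.eval x h) =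
          SignType.sign (MvPolynomial.eval y h)) → ∀ t, ∃ t', ∀ j,
          SignType.sign ((P j).eval₂ (MvPolynomial.eval x) t) =
          SignType.sign ((P j).eval₂ (MvPolynomial.eval y) t') := by
  classical
  obtain ⟨H, hH⟩ := exists_finset_sign_determined (Finset.univ.image (genericPoly s d))
  refine ⟨H.card, H.sup fun h => h.totalDegree * d, fun n P hP hc => ?_⟩
  refine ⟨H.image (MvPolynomial.aeval fun jk : Fin s × ℕ => (P jk.1).coeff jk.2),
    Finset.card_image_le, ?_, ?_⟩
  · intro h hh
    obtain ⟨g, hg, rfl⟩ := Finset.mem_image.1 hh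
    exact (totalDegree_aeval_le g _ fun jk => hc jk.1 jk.2).trans
      (Finset.le_sup (f := fun h => MvPolynomial.totalDegree h * d) hg)
  · intro x y hxy t
    obtain ⟨t', ht'⟩ := hH ((MvPolynomial.eval x).comp
      (MvPolynomial.aeval fun jk : Fin s × ℕ => (P jk.1).coeff jk.2).toRingHom)
      ((MvPolynomial.eval y).comp
      (MvPolynomial.aeval fun jk : Fin s × ℕ => (P jk.1).coeff jk.2).toRingHom)
      (fun h hh => hxy _ (Finset.mem_image_of_mem _ hh)) t
    refine ⟨t', fun j => ?_⟩
    have := ht' _ (Finset.mem_image_of_mem _ (Finset.mem_univ j))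
    rwa [eval₂_genericPoly P hP, eval₂_genericPoly P hP] at this

/-- Elimination of one variable with bounds on the number and degrees of the polynomials. -/
theorem exists_uniform_sign_determined (s d : ℕ) :
    ∃ K D : ℕ, ∀ (n : ℕ) (κ : Type) [Fintype κ] (P : κ → (MvPolynomial (Fin n) ℝ)[X]),
      Fintype.card κ ≤ s → (∀ j, (P j).natDegree ≤ d) →
      (∀ j k, ((P j).coeff k).totalDegree ≤ d) →
      ∃ H : Finset (MvPolynomial (Fin n) ℝ), H.card ≤ K ∧ (∀ h ∈ H, h.totalDegree ≤ D) ∧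
        ∀ x y, (∀ h ∈ H, SignType.sign (MvPolynomial.eval x h) =
          SignType.sign (MvPolynomial.eval y h)) → ∀ t, ∃ t', ∀ j,
          SignType.sign ((P j).eval₂ (MvPolynomial.eval x) t) =
          SignType.sign ((P j).eval₂ (MvPolynomial.eval y) t') := by
  obtain ⟨K, D, h⟩ := exists_uniform_sign_determined_fin s d
  refine ⟨K, D, fun n κ _ P hκ hP hc => ?_⟩
  obtain ⟨emb⟩ : Nonempty (κ ↪ Fin s) := Function.Embedding.nonempty_of_card_le (by simpa using hκ)
  have key : ∀ {p : (MvPolynomial (Fin n) ℝ)[X] → Prop}, p 0 → (∀ j, p (P j)) →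
      ∀ j, p (Function.extend emb P 0 j) := by
    intro p h0 hp j
    by_cases hj : ∃ i, emb i = j
    · obtain ⟨i, rfl⟩ := hj
      rw [emb.injective.extend_apply]
      exact hp i
    · rw [Function.extend_apply' _ _ _ hj]
      exact h0
  obtain ⟨H, h1, h2, h3⟩ := h n (Function.extend emb P 0)
    (key (p := fun q => q.natDegree ≤ d) (by simp) hP)
    (key (p := fun q => ∀ k, (q.coeff k).totalDegree ≤ d) (by simp) hc)
  refine ⟨H, h1, h2, fun x y hxy t => ?_⟩
  obtain ⟨t', ht'⟩ := h3 x y hxy t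
  refine ⟨t', fun j => ?_⟩
  simpa only [emb.injective.extend_apply] using ht' (emb j)

end UniformBounds

section Shear

open MvPolynomial

/-- The polynomial change of coordinates `x ↦ (x₀, x₁ + c x₀ ^ u, x₂ + c x₀ ^ u², …)`. -/
def shearMap {n : ℕ} (u : ℕ) (c : ℝ) (x : Fin (n + 1) → ℝ) : Fin (n + 1) → ℝ :=
  fun i => if i = 0 then x 0 else x i + c * x 0 ^ u ^ (i : ℕ)

theorem shearMap_shearMap_neg {n : ℕ} (u : ℕ) (c : ℝ) (x : Fin (n + 1) → ℝ) :
    shearMap u c (shearMap u (-c) x) = x := by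
  ext i
  by_cases h : i = 0 <;> simp [shearMap, h]

theorem shearMap_neg_shearMap {n : ℕ} (u : ℕ) (c : ℝ) (x : Fin (n + 1) → ℝ) :
    shearMap u (-c) (shearMap u c x) = x := by
  ext i
  by_cases h : i = 0 <;> simp [shearMap, h]

/-- The action of `shearMap` on polynomials. -/
noncomputable def shear {n : ℕ} (u : ℕ) (c : ℝ) :
    MvPolynomial (Fin (n + 1)) ℝ →ₐ[ℝ] MvPolynomial (Fin (n + 1)) ℝ :=
  aeval fun i => if i = 0 then X 0 else X i + c • X 0 ^ u ^ (i : ℕ)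

theorem eval_shear {n : ℕ} (u : ℕ) (c : ℝ) (x : Fin (n + 1) → ℝ)
    (f : MvPolynomial (Fin (n + 1)) ℝ) : eval x (shear u c f) = eval (shearMap u c x) f := by
  have : ((aeval x : MvPolynomial (Fin (n + 1)) ℝ →ₐ[ℝ] ℝ).comp (shear u c)) =
      aeval (shearMap u c x) := by
    ext i
    by_cases h : i = 0 <;> simp [shear, shearMap, h]
  simpa [aeval_eq_eval] using DFunLike.congr_fun this f

theorem totalDegree_shear_X_le {n : ℕ} (u : ℕ) (c : ℝ) (i : Fin (n + 1)) :
    (if i = 0 then X 0 else X i + c • X 0 ^ u ^ (i : ℕ) :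
      MvPolynomial (Fin (n + 1)) ℝ).totalDegree ≤ 1 + u ^ (i : ℕ) := by
  split_ifs with h
  · simp
  · refine (totalDegree_add _ _).trans (max_le (by simp) ?_)
    refine (totalDegree_smul_le _ _).trans ?_
    simp

theorem totalDegree_shear_le {n u : ℕ} (hu : 0 < u) (c : ℝ) (f : MvPolynomial (Fin (n + 1)) ℝ) :
    (shear u c f).totalDegree ≤ f.totalDegree * (1 + u ^ n) :=
  totalDegree_aeval_le f _ fun i => (totalDegree_shear_X_le u c i).trans
    (by gcongr; exact Nat.lt_succ_iff.1 i.2)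

theorem sum_pow_mul_ne {n u : ℕ} (hu : 1 < u) {v w : Fin (n + 1) →₀ ℕ} (vlt : ∀ i, v i < u)
    (wlt : ∀ i, w i < u) (ne : v ≠ w) :
    ∑ x : Fin (n + 1), u ^ (x : ℕ) * v x ≠ ∑ x : Fin (n + 1), u ^ (x : ℕ) * w x := by
  intro h
  refine ne <| Finsupp.ext <| congrFun <| List.ofFn_inj.mp ?_
  apply Nat.ofDigits_inj_of_len_eq hu (by simp)
    (fun l hl => by obtain ⟨i, rfl⟩ := (List.mem_ofFn' _ _).1 hl; exact vlt i)
    (fun l hl => by obtain ⟨i, rfl⟩ := (List.mem_ofFn' _ _).1 hl; exact wlt i)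
  simpa only [Nat.ofDigits_eq_sum_mapIdx, List.mapIdx_eq_ofFn, List.get_ofFn, List.length_ofFn,
    Fin.val_cast, mul_comm, List.sum_ofFn] using! h

theorem finSuccEquiv_shear_X {n u : ℕ} (hu : 1 < u) (i : Fin (n + 1)) :
    ((finSuccEquiv ℝ n) (shear u 1 (X i))).Monic ∧
      ((finSuccEquiv ℝ n) (shear u 1 (X i))).natDegree = u ^ (i : ℕ) := by
  by_cases h : i = 0
  · subst h
    simp [shear, finSuccEquiv_X_zero, Polynomial.monic_X]
  · obtain ⟨j, rfl⟩ := Fin.exists_succ_eq.mpr h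
    have hN : u ^ ((j.succ : Fin (n + 1)) : ℕ) ≠ 0 := pow_ne_zero _ (by omega)
    simp only [shear, aeval_X, if_neg h, one_smul, map_add, map_pow, finSuccEquiv_X_zero,
      finSuccEquiv_X_succ, add_comm (Polynomial.C _)]
    generalize u ^ ((j.succ : Fin (n + 1)) : ℕ) = N at hN
    exact ⟨Polynomial.monic_X_pow_add_C _ hN, Polynomial.natDegree_X_pow_add_C⟩

theorem finSuccEquiv_shear_monomial {n u : ℕ} (hu : 1 < u) (v : Fin (n + 1) →₀ ℕ) {a : ℝ} (ha : a ≠ 0) :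
    (finSuccEquiv ℝ n (shear u 1 (monomial v a))).leadingCoeff = C a ∧
    (finSuccEquiv ℝ n (shear u 1 (monomial v a))).natDegree =
      ∑ i : Fin (n + 1), u ^ (i : ℕ) * v i := by
  have hmon : (∏ i, (finSuccEquiv ℝ n (shear u 1 (X i))) ^ v i).Monic :=
    Polynomial.monic_prod_of_monic _ _ fun i _ => (finSuccEquiv_shear_X hu i).1.pow _
  have heq : finSuccEquiv ℝ n (shear u 1 (monomial v a)) =
      Polynomial.C (C a) * ∏ i, (finSuccEquiv ℝ n (shear u 1 (X i))) ^ v i := by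
    rw [monomial_eq, Finsupp.prod_pow, map_mul, map_mul, map_prod, map_prod]
    simp only [map_pow]
    congr 1
    simp only [shear, algHom_C, algebraMap_eq, finSuccEquiv_apply, eval₂Hom_C, RingHom.comp_apply]
  rw [heq]
  constructor
  · rw [Polynomial.leadingCoeff_mul, hmon.leadingCoeff, Polynomial.leadingCoeff_C, mul_one]
  · rw [Polynomial.natDegree_C_mul (by simpa using ha), 
      Polynomial.natDegree_prod_of_monic _ _ fun i _ => (finSuccEquiv_shear_X hu i).1.pow _]
    refine Finset.sum_congr rfl fun i _ => ?_
    rw [(finSuccEquiv_shear_X hu i).1.natDegree_pow, (finSuccEquiv_shear_X hu i).2, mul_comm]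

/-- After a shear with large exponent, a nonzero polynomial becomes monic in the variable `x₀`,
up to a constant. -/
theorem leadingCoeff_shear {n u : ℕ} (hu : 1 < u) (f : MvPolynomial (Fin (n + 1)) ℝ) (hf : f ≠ 0)
    (hfu : f.totalDegree < u) :
    ∃ a : ℝ, a ≠ 0 ∧ (finSuccEquiv ℝ n (shear u 1 f)).leadingCoeff = C a := by
  classical
  set h : (Fin (n + 1) →₀ ℕ) → Polynomial (MvPolynomial (Fin n) ℝ) :=
    fun w => finSuccEquiv ℝ n (shear u 1 (monomial w (coeff w f))) with hh
  obtain ⟨v, vin, vs⟩ := Finset.exists_max_image f.support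
    (fun v => (h v).natDegree) (support_nonempty.mpr hf)
  have hcv : coeff v f ≠ 0 := mem_support_iff.1 vin
  have hlt : ∀ w ∈ f.support, ∀ i, w i < u := fun w hw i =>
    ((monomial_le_degreeOf i hw).trans (degreeOf_le_totalDegree f i)).trans_lt hfu
  have hne : h v ≠ 0 := by
    rw [← Polynomial.leadingCoeff_ne_zero, (finSuccEquiv_shear_monomial hu v hcv).1]
    simpa using hcv
  have hdeg : (∑ w ∈ f.support.erase v, h w).degree < (h v).degree := by
    refine (Polynomial.degree_sum_le _ _).trans_lt ((Finset.sup_lt_iff (Ne.bot_lt fun x =>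
      hne (Polynomial.degree_eq_bot.1 x))).2 fun w hw => ?_)
    obtain ⟨hwv, hw⟩ := Finset.mem_erase.1 hw
    refine Polynomial.degree_lt_degree (lt_of_le_of_ne (vs w hw) ?_)
    rw [(finSuccEquiv_shear_monomial hu v hcv).2,
      (finSuccEquiv_shear_monomial hu w (mem_support_iff.1 hw)).2]
    exact sum_pow_mul_ne hu (hlt w hw) (hlt v vin) hwv
  refine ⟨coeff v f, hcv, ?_⟩
  have hsum : finSuccEquiv ℝ n (shear u 1 f) = (∑ w ∈ f.support.erase v, h w) + h v := by
    conv_lhs => rw [← f.support_sum_monomial_coeff]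
    rw [map_sum, map_sum, Finset.sum_erase_add _ _ vin]
  rw [hsum, Polynomial.leadingCoeff_add_of_degree_lt hdeg,
    (finSuccEquiv_shear_monomial hu v hcv).1]

end Shear

section Fibres

open Polynomial Filter Topology

/-- A family of polynomials in one variable, monic up to real constants and closed under
nonzero derivatives. -/
structure IsThomFamily {n : ℕ} {κ : Type} (P : κ → (MvPolynomial (Fin n) ℝ)[X]) : Prop where
  leadingCoeff : ∀ k, ∃ a : ℝ, a ≠ 0 ∧ (P k).leadingCoeff = MvPolynomial.C a
  derivative : ∀ k, derivative (P k) = 0 ∨ ∃ k', P k' = derivative (P k)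

/-- The points of the fibre over `x` where the family has prescribed signs. -/
def signFibre {n : ℕ} {κ : Type} (P : κ → (MvPolynomial (Fin n) ℝ)[X]) (σ : κ → SignType)
    (x : Fin n → ℝ) : Set ℝ :=
  {t | ∀ k, SignType.sign ((P k).eval₂ (MvPolynomial.eval x) t) = σ k}

/-- The points of the fibre over `x` where the family has prescribed signs or vanishes. -/
def weakSignFibre {n : ℕ} {κ : Type} (P : κ → (MvPolynomial (Fin n) ℝ)[X]) (σ : κ → SignType)
    (x : Fin n → ℝ) : Set ℝ :=
  {t | ∀ k, SignType.sign ((P k).eval₂ (MvPolynomial.eval x) t) = σ k ∨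
    (P k).eval₂ (MvPolynomial.eval x) t = 0}

theorem sign_eq_or_eq_zero_iff (s : SignType) (v : ℝ) : (SignType.sign v = s ∨ v = 0) ↔
    (s = 0 ∧ v = 0) ∨ (s = 1 ∧ 0 ≤ v) ∨ (s = -1 ∧ v ≤ 0) := by
  rcases lt_trichotomy v 0 with h | h | h
  · have h1 := h.ne; have h2 := h.le; have h3 := not_le.2 h
    cases s <;> simp [sign_neg h, h1, h2, h3]
  · subst h; cases s <;> simp
  · have h1 := h.ne'; have h2 := h.le; have h3 := not_le.2 h
    cases s <;> simp [sign_pos h, h1, h2, h3]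

theorem sign_eq_or_eq_zero_of_mem_uIcc {s : SignType} {a b c : ℝ}
    (ha : SignType.sign a = s ∨ a = 0) (hb : SignType.sign b = s ∨ b = 0) (hc : c ∈ uIcc a b) :
    SignType.sign c = s ∨ c = 0 := by
  rw [sign_eq_or_eq_zero_iff] at *
  rw [mem_uIcc] at hc
  rcases ha with ⟨rfl, ha⟩ | ⟨rfl, ha⟩ | ⟨rfl, ha⟩ <;> simp at hb ⊢ <;>
    rcases hc with hc | hc <;> linarith

theorem sign_eq_of_mem_uIcc {s : SignType} {a b c : ℝ}
    (ha : SignType.sign a = s) (hb : SignType.sign b = s) (hc : c ∈ uIcc a b) :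
    SignType.sign c = s := by
  rw [mem_uIcc] at hc
  cases s
  · have ha : SignType.sign a = 0 := ha
    have hb : SignType.sign b = 0 := hb
    rw [sign_eq_zero_iff] at ha hb
    have : c = 0 := by rcases hc with hc | hc <;> apply le_antisymm <;> linarith
    simp [this]
  · have ha : SignType.sign a = -1 := ha
    have hb : SignType.sign b = -1 := hb
    rw [sign_eq_neg_one_iff] at ha hb
    exact sign_neg (by rcases hc with hc | hc <;> linarith)
  · have ha : SignType.sign a = 1 := ha
    have hb : SignType.sign b = 1 := hb
    rw [sign_eq_one_iff] at ha hb
    exact sign_pos (by rcases hc with hc | hc <;> linarith)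

variable {n : ℕ} {κ : Type} {P : κ → (MvPolynomial (Fin n) ℝ)[X]} {σ : κ → SignType}
  {x : Fin n → ℝ}

theorem signFibre_subset_weakSignFibre : signFibre P σ x ⊆ weakSignFibre P σ x :=
  fun _ ht k => Or.inl (ht k)

/-- Between two points with the same weak signs, each member of the family is monotone
(**Thom's lemma**). -/
theorem IsThomFamily.eval₂_mem_uIcc (hP : IsThomFamily P) {t₁ t₂ : ℝ}
    (h₁ : t₁ ∈ weakSignFibre P σ x) (h₂ : t₂ ∈ weakSignFibre P σ x) (k : κ) :
    ∀ t ∈ Icc t₁ t₂, (P k).eval₂ (MvPolynomial.eval x) t ∈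
      uIcc ((P k).eval₂ (MvPolynomial.eval x) t₁) ((P k).eval₂ (MvPolynomial.eval x) t₂) := by
  induction hd : (P k).natDegree using Nat.strong_induction_on generalizing k with
  | _ d ih =>
  intro t ht
  have hcont : ContinuousOn (fun t => (P k).eval₂ (MvPolynomial.eval x) t) (Icc t₁ t₂) :=
    (continuous_eval₂ (P k) (MvPolynomial.eval x)).continuousOn
  have hle : t₁ ≤ t₂ := ht.1.trans ht.2
  have hdiff : DifferentiableOn ℝ (fun t => (P k).eval₂ (MvPolynomial.eval x) t)
      (interior (Icc t₁ t₂)) := fun t _ =>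
    (hasDerivAt_eval₂ (P k) (MvPolynomial.eval x) t).differentiableAt.differentiableWithinAt
  have hderiv : ∀ t, deriv (fun t => (P k).eval₂ (MvPolynomial.eval x) t) t =
      (Polynomial.derivative (P k)).eval₂ (MvPolynomial.eval x) t := fun t =>
    (hasDerivAt_eval₂ (P k) (MvPolynomial.eval x) t).deriv
  have key : (∀ t ∈ Icc t₁ t₂, 0 ≤ (Polynomial.derivative (P k)).eval₂ (MvPolynomial.eval x) t) ∨
      (∀ t ∈ Icc t₁ t₂, (Polynomial.derivative (P k)).eval₂ (MvPolynomial.eval x) t ≤ 0) := by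
    rcases hP.derivative k with h0 | ⟨k', hk'⟩
    · simp [h0]
    · have hlt : (P k').natDegree < d := by
        rw [hk', ← hd]
        refine natDegree_derivative_lt fun h0 => ?_
        obtain ⟨a, ha, hl⟩ := hP.leadingCoeff k'
        rw [hk', derivative_of_natDegree_zero h0, leadingCoeff_zero] at hl
        exact ha (by simpa using hl.symm)
      have := fun t ht => sign_eq_or_eq_zero_of_mem_uIcc (h₁ k') (h₂ k') (ih _ hlt k' rfl t ht)
      simp only [sign_eq_or_eq_zero_iff, hk'] at this
      by_cases hs : σ k' = 1
      · left
        intro t ht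
        have := this t ht
        simp [hs] at this
        exact this
      · right
        intro t ht
        rcases this t ht with h | h | h
        exacts [h.2.le, absurd h.1 hs, h.2]
  rw [mem_uIcc]
  rcases key with h | h
  · left
    have := monotoneOn_of_deriv_nonneg (convex_Icc t₁ t₂) hcont hdiff
      (fun t ht => by rw [hderiv]; exact h t (interior_subset ht))
    exact ⟨this (left_mem_Icc.2 hle) ht ht.1, this ht (right_mem_Icc.2 hle) ht.2⟩
  · right
    have := antitoneOn_of_deriv_nonpos (convex_Icc t₁ t₂) hcont hdiff
      (fun t ht => by rw [hderiv]; exact h t (interior_subset ht))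
    exact ⟨this ht (right_mem_Icc.2 hle) ht.2, this (left_mem_Icc.2 hle) ht ht.1⟩

theorem IsThomFamily.ordConnected_signFibre (hP : IsThomFamily P) :
    OrdConnected (signFibre P σ x) :=
  ⟨fun _ h₁ _ h₂ t ht k => sign_eq_of_mem_uIcc (h₁ k) (h₂ k) (hP.eval₂_mem_uIcc
    (signFibre_subset_weakSignFibre h₁) (signFibre_subset_weakSignFibre h₂) k t ht)⟩

theorem IsThomFamily.ordConnected_weakSignFibre (hP : IsThomFamily P) :
    OrdConnected (weakSignFibre P σ x) :=
  ⟨fun _ h₁ _ h₂ t ht k => sign_eq_or_eq_zero_of_mem_uIcc (h₁ k) (h₂ k)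
    (hP.eval₂_mem_uIcc h₁ h₂ k t ht)⟩

end Fibres

section Fibres

open Polynomial Filter Topology

theorem eventually_sign_eq_of_ne_zero {X : Type*} [TopologicalSpace X] {f : X → ℝ} {x : X}
    (hf : ContinuousAt f x) (h : f x ≠ 0) :
    ∀ᶠ y in 𝓝 x, SignType.sign (f y) = SignType.sign (f x) := by
  rcases h.lt_or_gt with h | h
  · filter_upwards [hf.eventually_lt_const h] with y hy
    rw [sign_neg hy, sign_neg h]
  · filter_upwards [hf.eventually_const_lt h] with y hy
    rw [sign_pos hy, sign_pos h]

theorem sign_eq_of_forall_ne_zero {f : ℝ → ℝ} (hf : Continuous f) {a b : ℝ}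
    (h : ∀ t ∈ uIcc a b, f t ≠ 0) : SignType.sign (f a) = SignType.sign (f b) := by
  have h0 : (0 : ℝ) ∉ uIcc (f a) (f b) := fun h0 => by
    obtain ⟨t, ht, ht0⟩ := intermediate_value_uIcc hf.continuousOn h0
    exact h t ht ht0
  rw [mem_uIcc] at h0
  push Not at h0
  rcases (h a left_mem_uIcc).lt_or_gt with ha | ha
  · rw [sign_neg ha, sign_neg (h0.1 ha.le)]
  · rw [sign_pos ha, sign_pos]
    by_contra! hb
    exact (h0.2 hb).not_ge ha.le

variable {n : ℕ} {κ : Type} {P : κ → (MvPolynomial (Fin n) ℝ)[X]} {σ : κ → SignType}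
  {x : Fin n → ℝ}

theorem continuous_eval₂_eval (p : (MvPolynomial (Fin n) ℝ)[X]) :
    Continuous fun z : (Fin n → ℝ) × ℝ => p.eval₂ (MvPolynomial.eval z.1) z.2 := by
  simp only [eval₂_eq_sum_range]
  refine continuous_finsetSum _ fun i _ => Continuous.mul ?_ (continuous_snd.pow i)
  exact (MvPolynomial.continuous_eval _).comp continuous_fst

theorem IsThomFamily.map_ne_zero (hP : IsThomFamily P) (k : κ) (x : Fin n → ℝ) :
    (P k).map (MvPolynomial.eval x) ≠ 0 := by
  obtain ⟨a, ha, hl⟩ := hP.leadingCoeff k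
  rw [← leadingCoeff_ne_zero, leadingCoeff_map_of_leadingCoeff_ne_zero _ (by simpa [hl] using ha), hl]
  simpa using ha

theorem IsThomFamily.finite_roots (hP : IsThomFamily P) [Finite κ] (x : Fin n → ℝ) :
    {t | ∃ k, (P k).eval₂ (MvPolynomial.eval x) t = 0}.Finite := by
  rw [ofPred_exists]
  refine finite_iUnion fun k => ?_
  have := Multiset.finite_toSet ((P k).map (MvPolynomial.eval x)).roots
  refine this.subset fun t ht => ?_
  rw [Set.mem_ofPred_eq, mem_roots (hP.map_ne_zero k x), IsRoot, ← eval₂_eq_eval_map]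
  exact ht

theorem IsThomFamily.exists_root_bound (hP : IsThomFamily P) [Finite κ] (x : Fin n → ℝ) :
    ∃ M : ℝ, 0 ≤ M ∧ ∀ᶠ y in 𝓝 x, ∀ k t, (P k).eval₂ (MvPolynomial.eval y) t = 0 → |t| < M := by
  have key : ∀ k, ∃ M : ℝ, ∀ᶠ y in 𝓝 x, ∀ t,
      (P k).eval₂ (MvPolynomial.eval y) t = 0 → |t| < M := by
    intro k
    obtain ⟨a, ha, hl⟩ := hP.leadingCoeff k
    have hl' : ∀ y, MvPolynomial.eval y (P k).leadingCoeff ≠ 0 := by simpa [hl] using ha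
    have hc : Continuous fun y => cauchyBound ((P k).map (MvPolynomial.eval y)) := by
      have : (fun y => cauchyBound ((P k).map (MvPolynomial.eval y))) = fun y =>
          (Finset.range (P k).natDegree).sup
            (fun i => ‖MvPolynomial.eval y ((P k).coeff i)‖₊) / ‖a‖₊ + 1 := by
        ext y
        rw [cauchyBound, natDegree_map_of_leadingCoeff_ne_zero _ (hl' y),
          leadingCoeff_map_of_leadingCoeff_ne_zero _ (hl' y), hl]
        simp
      rw [this]
      refine Continuous.add (Continuous.div_const ?_ _) continuous_const
      exact Continuous.finset_sup_apply fun i _ => (MvPolynomial.continuous_eval _).nnnorm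
    refine ⟨cauchyBound ((P k).map (MvPolynomial.eval x)) + 1, ?_⟩
    have hlt : cauchyBound ((P k).map (MvPolynomial.eval x)) <
      cauchyBound ((P k).map (MvPolynomial.eval x)) + 1 := by simp
    filter_upwards [hc.continuousAt.eventually_lt_const hlt] with y hy t ht
    have hr : ((P k).map (MvPolynomial.eval y)).IsRoot t := by
      rwa [IsRoot, ← eval₂_eq_eval_map]
    have := (hr.norm_lt_cauchyBound (hP.map_ne_zero k y)).trans hy
    exact_mod_cast this
  choose M hM using key
  have := Fintype.ofFinite κ
  refine ⟨∑ k, |M k|, Finset.sum_nonneg fun k _ => abs_nonneg _, ?_⟩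
  filter_upwards [eventually_all.2 hM] with y hy k t ht
  exact ((hy k t ht).trans_le (le_abs_self _)).trans_le
    (Finset.single_le_sum (f := fun k => |M k|) (fun k _ => abs_nonneg _) (Finset.mem_univ k))

theorem IsThomFamily.exists_mem_Icc (hP : IsThomFamily P) [Finite κ] (σ : κ → SignType)
    (x : Fin n → ℝ) : ∃ M : ℝ, ∀ᶠ y in 𝓝 x, (signFibre P σ y).Nonempty →
      ∃ s ∈ Icc (-M) M, s ∈ signFibre P σ y := by
  obtain ⟨M, hM0, hM⟩ := hP.exists_root_bound x
  refine ⟨M, ?_⟩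
  filter_upwards [hM] with y hy
  rintro ⟨s, hs⟩
  rcases lt_or_ge s (-M) with h1 | h1
  · refine ⟨-M, by simpa using hM0, fun k => ?_⟩
    rw [← hs k]
    refine sign_eq_of_forall_ne_zero (continuous_eval₂ _ _) fun t ht h0 => ?_
    have := abs_lt.1 (hy k t h0)
    rw [uIcc_of_ge h1.le] at ht
    linarith [ht.2]
  rcases lt_or_ge M s with h2 | h2
  · refine ⟨M, by simpa using hM0, fun k => ?_⟩
    rw [← hs k]
    refine sign_eq_of_forall_ne_zero (continuous_eval₂ _ _) fun t ht h0 => ?_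
    have := abs_lt.1 (hy k t h0)
    rw [uIcc_of_le h2.le] at ht
    linarith [ht.1]
  exact ⟨s, ⟨h1, h2⟩, hs⟩

/-- Lower hemicontinuity of the fibres with prescribed signs, up to the boundary. -/
theorem IsThomFamily.eventually_exists_mem_signFibre (hP : IsThomFamily P) [Finite κ]
    {C : Set (Fin n → ℝ)} (hC : ∀ y ∈ C, (signFibre P σ y).Nonempty) {t : ℝ}
    (ht : t ∈ weakSignFibre P σ x) {W : Set ℝ} (hW : W ∈ 𝓝 t) :
    ∀ᶠ y in 𝓝[C] x, ∃ s ∈ W, s ∈ signFibre P σ y := by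
  by_cases hsub : (weakSignFibre P σ x).Subsingleton
  · obtain ⟨M, hM⟩ := hP.exists_mem_Icc σ x
    have hK : IsCompact (Icc (-M) M \ interior W) := isCompact_Icc.diff isOpen_interior
    have hKe : ∀ᶠ y in 𝓝 x, ∀ s ∈ Icc (-M) M \ interior W, s ∉ signFibre P σ y := by
      refine hK.eventually_forall_of_forall_eventually fun s hs => ?_
      have hs' : s ∉ weakSignFibre P σ x := fun h =>
        hs.2 (hsub ht h ▸ mem_interior_iff_mem_nhds.2 hW)
      simp only [weakSignFibre, Set.mem_ofPred_eq, not_forall, not_or] at hs'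
      obtain ⟨k, hk1, hk2⟩ := hs'
      filter_upwards [eventually_sign_eq_of_ne_zero
        (continuous_eval₂_eval (P k)).continuousAt (x := (x, s)) hk2] with z hz hz'
      exact hk1 (by rw [← hz, hz' k])
    filter_upwards [hM.filter_mono nhdsWithin_le_nhds, hKe.filter_mono nhdsWithin_le_nhds,
      self_mem_nhdsWithin] with y h1 h2 h3
    obtain ⟨s, hs, hs'⟩ := h1 (hC y h3)
    refine ⟨s, ?_, hs'⟩
    by_contra hsW
    exact h2 s ⟨hs, fun h => hsW (interior_subset h)⟩ hs'
  · obtain ⟨t', ht', hne⟩ : ∃ t' ∈ weakSignFibre P σ x, t' ≠ t := by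
      by_contra! h
      exact hsub fun a ha b hb => (h a ha).trans (h b hb).symm
    obtain ⟨a, b, hab, hsubW, hsubI⟩ : ∃ a b, a < b ∧ Ioo a b ⊆ W ∧ Ioo a b ⊆ uIcc t t' := by
      rcases hne.lt_or_gt with h | h
      · obtain ⟨l, hl, hl'⟩ := (mem_nhdsLT_iff_exists_Ioo_subset' h).1
          (inter_mem (nhdsWithin_le_nhds hW) (Ioo_mem_nhdsLT h))
        refine ⟨l, t, hl, fun s hs => (hl' hs).1, fun s hs => ?_⟩
        rw [uIcc_of_ge h.le]
        exact Ioo_subset_Icc_self (hl' hs).2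
      · obtain ⟨l, hl, hl'⟩ := (mem_nhdsGT_iff_exists_Ioo_subset' h).1
          (inter_mem (nhdsWithin_le_nhds hW) (Ioo_mem_nhdsGT h))
        refine ⟨t, l, hl, fun s hs => (hl' hs).1, fun s hs => ?_⟩
        rw [uIcc_of_le h.le]
        exact Ioo_subset_Icc_self (hl' hs).2
    obtain ⟨s, hs, hs0⟩ := ((Ioo_infinite hab).sdiff (hP.finite_roots x)).nonempty
    have hsR := hP.ordConnected_weakSignFibre.uIcc_subset ht ht' (hsubI hs)
    have : ∀ k, ∀ᶠ y in 𝓝 x, SignType.sign ((P k).eval₂ (MvPolynomial.eval y) s) = σ k := by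
      intro k
      have hk0 : (P k).eval₂ (MvPolynomial.eval x) s ≠ 0 := fun h => hs0 ⟨k, h⟩
      rw [← (hsR k).resolve_right hk0]
      exact eventually_sign_eq_of_ne_zero
        (f := fun y => (P k).eval₂ (MvPolynomial.eval y) s)
        ((continuous_eval₂_eval (P k)).comp (.prodMk_left s)).continuousAt hk0
    filter_upwards [(eventually_all.2 this).filter_mono nhdsWithin_le_nhds] with y hy
    exact ⟨s, hsubW hs, hy⟩

end Fibres

section Submanifolds

open Filter Topology

/-- An analytic diffeomorphism `E : U → V` between open sets, with inverse `E'`. -/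
structure IsAnalyticDiffeoOn {d : ℕ} (E E' : (Fin d → ℝ) → (Fin d → ℝ))
    (U V : Set (Fin d → ℝ)) : Prop where
  isOpen_source : IsOpen U
  isOpen_target : IsOpen V
  analyticOnNhd : AnalyticOnNhd ℝ E U
  analyticOnNhd_symm : AnalyticOnNhd ℝ E' V
  mapsTo : ∀ y ∈ U, E y ∈ V
  mapsTo_symm : ∀ z ∈ V, E' z ∈ U
  left_inv : ∀ y ∈ U, E' (E y) = y
  right_inv : ∀ z ∈ V, E (E' z) = z

theorem IsAnalyticDiffeoOn.id {d : ℕ} {U : Set (Fin d → ℝ)} (hU : IsOpen U) :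
    IsAnalyticDiffeoOn id id U U :=
  ⟨hU, hU, analyticOnNhd_id, analyticOnNhd_id, fun _ h => h, fun _ h => h, fun _ _ => rfl,
    fun _ _ => rfl⟩

/-- Being a submanifold is invariant under local analytic diffeomorphisms of the ambient space. -/
theorem IsAnalyticSubmanifold.of_local_diffeo {d m : ℕ} {A B : Set (Fin d → ℝ)}
    (hB : IsAnalyticSubmanifold B m)
    (h : ∀ z ∈ A, ∃ E E' U V, IsAnalyticDiffeoOn E E' U V ∧ z ∈ U ∧ ∀ y ∈ U, y ∈ A ↔ E y ∈ B) :
    IsAnalyticSubmanifold A m := by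
  intro z hz
  obtain ⟨E, E', U, V, hE, hzU, hAB⟩ := h z hz
  obtain ⟨U₁, V₁, φ, ψ, hU₁, hV₁, hzU₁, hφ, hψ, hφV, hψU, hψφ, hφψ, him⟩ :=
    hB (E z) ((hAB z hzU).1 hz)
  refine ⟨U ∩ E ⁻¹' U₁, V₁ ∩ ψ ⁻¹' V, φ ∘ E, E' ∘ ψ,
    hE.analyticOnNhd.continuousOn.isOpen_inter_preimage hE.isOpen_source hU₁,
    hψ.continuousOn.isOpen_inter_preimage hV₁ hE.isOpen_target, ⟨hzU, hzU₁⟩, ?_, ?_, ?_, ?_, ?_, ?_,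
    ?_⟩
  · exact hφ.comp (hE.analyticOnNhd.mono inter_subset_left) fun y hy => hy.2
  · exact hE.analyticOnNhd_symm.comp (hψ.mono inter_subset_left) fun y hy => hy.2
  · rintro y ⟨hy, hy'⟩
    refine ⟨hφV _ hy', ?_⟩
    rw [mem_preimage, Function.comp_apply, hψφ _ hy']
    exact hE.mapsTo y hy
  · rintro v ⟨hv, hv'⟩
    refine ⟨hE.mapsTo_symm _ hv', ?_⟩
    rw [mem_preimage, Function.comp_apply, hE.right_inv _ hv']
    exact hψU v hv
  · rintro y ⟨hy, hy'⟩
    rw [Function.comp_apply, Function.comp_apply, hψφ _ hy', hE.left_inv _ hy]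
  · rintro v ⟨hv, hv'⟩
    rw [Function.comp_apply, Function.comp_apply, hE.right_inv _ hv', hφψ _ hv]
  · ext v
    constructor
    · rintro ⟨y, ⟨⟨hy, hy'⟩, hyA⟩, rfl⟩
      have : φ (E y) ∈ φ '' (U₁ ∩ B) := mem_image_of_mem _ ⟨hy', (hAB y hy).1 hyA⟩
      rw [him] at this
      refine ⟨⟨this.1, ?_⟩, this.2⟩
      rw [mem_preimage, Function.comp_apply, hψφ _ hy']
      exact hE.mapsTo y hy
    · rintro ⟨⟨hv, hv'⟩, hv0⟩
      have : v ∈ φ '' (U₁ ∩ B) := by rw [him]; exact ⟨hv, hv0⟩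
      obtain ⟨b, ⟨hb, hbB⟩, rfl⟩ := this
      rw [mem_preimage, hψφ _ hb] at hv'
      refine ⟨E' b, ⟨⟨hE.mapsTo_symm _ hv', ?_⟩, ?_⟩, ?_⟩
      · rwa [mem_preimage, hE.right_inv _ hv']
      · rwa [hAB _ (hE.mapsTo_symm _ hv'), hE.right_inv _ hv']
      · rw [Function.comp_apply, hE.right_inv _ hv']

/-- The analytic inverse function theorem. -/
theorem exists_isAnalyticDiffeoOn {d : ℕ} {E : (Fin d → ℝ) → (Fin d → ℝ)}
    (hE : AnalyticOnNhd ℝ E univ) {a : Fin d → ℝ}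
    (hinj : Function.Injective (fderiv ℝ E a)) {N : Set (Fin d → ℝ)} (hN : N ∈ 𝓝 a) :
    ∃ E' U V, IsAnalyticDiffeoOn E E' U V ∧ a ∈ U ∧ U ⊆ N := by
  let L : (Fin d → ℝ) ≃L[ℝ] (Fin d → ℝ) :=
    (LinearEquiv.ofInjectiveEndo (fderiv ℝ E a : (Fin d → ℝ) →ₗ[ℝ] (Fin d → ℝ)) hinj
      ).toContinuousLinearEquiv
  have hL : fderiv ℝ E a = (L : (Fin d → ℝ) →L[ℝ] (Fin d → ℝ)) := by
    ext v
    rfl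
  have hs : HasStrictFDerivAt E (L : (Fin d → ℝ) →L[ℝ] (Fin d → ℝ)) a :=
    hL ▸ (hE a (mem_univ a)).hasStrictFDerivAt
  let e := hs.toOpenPartialHomeomorph E
  have hee : ∀ x, e x = E x := fun x => rfl
  have ha : a ∈ e.source := hs.mem_toOpenPartialHomeomorph_source
  have hsymm : AnalyticAt ℝ e.symm (e a) :=
    e.analyticAt_symm' ha (hE a (mem_univ a)) hL
  have hE0 : Continuous E := continuousOn_univ.1 hE.continuousOn
  refine ⟨e.symm, e.source ∩ (E ⁻¹' {v | AnalyticAt ℝ e.symm v} ∩ interior N),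
    e.target ∩ e.symm ⁻¹' interior N ∩ {v | AnalyticAt ℝ e.symm v}, ⟨?_, ?_, ?_, ?_, ?_, ?_, ?_, ?_⟩,
    ⟨ha, hsymm, mem_interior_iff_mem_nhds.2 hN⟩, fun y hy => interior_subset hy.2.2⟩
  · exact e.open_source.inter (((isOpen_analyticAt ℝ _).preimage hE0).inter isOpen_interior)
  · exact (e.isOpen_inter_preimage_symm isOpen_interior).inter (isOpen_analyticAt ℝ _)
  · exact hE.mono (subset_univ _)
  · exact fun v hv => hv.2
  · rintro y ⟨hy, hy1, hy2⟩
    refine ⟨⟨e.map_source hy, ?_⟩, hy1⟩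
    rw [mem_preimage, ← hee, e.left_inv hy]
    exact hy2
  · rintro v ⟨⟨hv, hv1⟩, hv2⟩
    refine ⟨e.map_target hv, ?_, hv1⟩
    rw [mem_preimage, ← hee, e.right_inv hv]
    exact hv2
  · exact fun y hy => e.left_inv hy.1
  · exact fun v hv => e.right_inv hv.1.1

theorem analyticOnNhd_apply {d : ℕ} (i : Fin d) (s : Set (Fin d → ℝ)) :
    AnalyticOnNhd ℝ (fun w : Fin d → ℝ => w i) s :=
  fun x _ => (ContinuousLinearMap.proj (R := ℝ) (φ := fun _ : Fin d => ℝ) i).analyticAt x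

theorem analyticOnNhd_tail {d : ℕ} (s : Set (Fin (d + 1) → ℝ)) :
    AnalyticOnNhd ℝ (fun w : Fin (d + 1) → ℝ => (Fin.tail w : Fin d → ℝ)) s :=
  AnalyticOnNhd.pi fun i => analyticOnNhd_apply i.succ s

theorem analyticOnNhd_init {d : ℕ} (s : Set (Fin (d + 1) → ℝ)) :
    AnalyticOnNhd ℝ (fun w : Fin (d + 1) → ℝ => (Fin.init w : Fin d → ℝ)) s :=
  AnalyticOnNhd.pi fun i => analyticOnNhd_apply i.castSucc s

theorem AnalyticOnNhd.fin_cons {d e : ℕ} {s : Set (Fin d → ℝ)} {f : (Fin d → ℝ) → ℝ}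
    {g : (Fin d → ℝ) → (Fin e → ℝ)} (hf : AnalyticOnNhd ℝ f s) (hg : AnalyticOnNhd ℝ g s) :
    AnalyticOnNhd ℝ (fun w => (Fin.cons (f w) (g w) : Fin (e + 1) → ℝ)) s := by
  refine AnalyticOnNhd.pi fun i => ?_
  refine Fin.cases ?_ (fun j => ?_) i
  · simpa using hf
  · simpa using analyticOnNhd_pi_iff.1 hg j

theorem AnalyticOnNhd.fin_snoc {d e : ℕ} {s : Set (Fin d → ℝ)} {f : (Fin d → ℝ) → ℝ}
    {g : (Fin d → ℝ) → (Fin e → ℝ)} (hf : AnalyticOnNhd ℝ f s) (hg : AnalyticOnNhd ℝ g s) :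
    AnalyticOnNhd ℝ (fun w => (Fin.snoc (g w) (f w) : Fin (e + 1) → ℝ)) s := by
  refine AnalyticOnNhd.pi fun i => ?_
  refine Fin.lastCases ?_ (fun j => ?_) i
  · simpa using hf
  · simpa using analyticOnNhd_pi_iff.1 hg j

theorem continuous_fin_tail {d : ℕ} : Continuous fun w : Fin (d + 1) → ℝ => (Fin.tail w : Fin d → ℝ) :=
  continuous_pi fun i => continuous_apply i.succ

theorem continuous_fin_init {d : ℕ} : Continuous fun w : Fin (d + 1) → ℝ => (Fin.init w : Fin d → ℝ) :=
  continuous_pi fun i => continuous_apply i.castSucc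

/-- The cylinder over a submanifold. -/
theorem IsAnalyticSubmanifold.cylinder {d m : ℕ} {A : Set (Fin d → ℝ)}
    (hA : IsAnalyticSubmanifold A m) :
    IsAnalyticSubmanifold {w : Fin (d + 1) → ℝ | Fin.tail w ∈ A} (m + 1) := by
  intro z hz
  obtain ⟨U, V, φ, ψ, hU, hV, hzU, hφ, hψ, hφV, hψU, hψφ, hφψ, him⟩ := hA _ hz
  refine ⟨{w | Fin.tail w ∈ U}, {w | Fin.tail w ∈ V}, fun w => Fin.cons (w 0) (φ (Fin.tail w)),
    fun w => Fin.cons (w 0) (ψ (Fin.tail w)), hU.preimage continuous_fin_tail,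
    hV.preimage continuous_fin_tail, hzU, (analyticOnNhd_apply 0 _).fin_cons
      (hφ.comp (analyticOnNhd_tail _) fun w hw => hw), (analyticOnNhd_apply 0 _).fin_cons
      (hψ.comp (analyticOnNhd_tail _) fun w hw => hw), ?_, ?_, ?_, ?_, ?_⟩
  · intro y hy
    simpa using hφV _ hy
  · intro y hy
    simpa using hψU _ hy
  · intro y hy
    have : ψ (φ (Fin.tail y)) = Fin.tail y := hψφ _ hy
    simp [this]
  · intro y hy
    have : φ (ψ (Fin.tail y)) = Fin.tail y := hφψ _ hy
    simp [this]
  · ext v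
    have key : Fin.tail v ∈ φ '' (U ∩ A) ↔ Fin.tail v ∈ V ∩ {z | ∀ i : Fin d, m ≤ (i : ℕ) → z i = 0} := by
      rw [him]
    constructor
    · rintro ⟨y, ⟨hy, hyA⟩, rfl⟩
      have := key.1 ⟨Fin.tail y, ⟨hy, hyA⟩, by simp⟩
      refine ⟨this.1, fun i => ?_⟩
      refine Fin.cases ?_ (fun j hj => ?_) i
      · simp
      · exact this.2 j (by simpa using hj)
    · rintro ⟨hv, hv0⟩
      obtain ⟨y, ⟨hy, hyA⟩, hyv⟩ := key.2 ⟨hv, fun i hi => hv0 i.succ (by simpa using hi)⟩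
      refine ⟨Fin.cons (v 0) y, ⟨by simpa using hy, by simpa using hyA⟩, ?_⟩
      simp [hyv]

/-- A submanifold, embedded in a coordinate hyperplane. -/
theorem IsAnalyticSubmanifold.hyperplane {d m : ℕ} {A : Set (Fin d → ℝ)} (hm : m ≤ d)
    (hA : IsAnalyticSubmanifold A m) :
    IsAnalyticSubmanifold {w : Fin (d + 1) → ℝ | Fin.tail w ∈ A ∧ w 0 = 0} m := by
  rintro z ⟨hz, -⟩
  obtain ⟨U, V, φ, ψ, hU, hV, hzU, hφ, hψ, hφV, hψU, hψφ, hφψ, him⟩ := hA _ hz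
  refine ⟨{w | Fin.tail w ∈ U}, {w | Fin.init w ∈ V}, fun w => Fin.snoc (φ (Fin.tail w)) (w 0),
    fun w => Fin.cons (w (Fin.last d)) (ψ (Fin.init w)), hU.preimage continuous_fin_tail,
    hV.preimage continuous_fin_init, hzU, (analyticOnNhd_apply 0 _).fin_snoc
      (hφ.comp (analyticOnNhd_tail _) fun w hw => hw), (analyticOnNhd_apply _ _).fin_cons
      (hψ.comp (analyticOnNhd_init _) fun w hw => hw), ?_, ?_, ?_, ?_, ?_⟩
  · intro y hy
    simpa using hφV _ hy
  · intro y hy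
    simpa using hψU _ hy
  · intro y hy
    have : ψ (φ (Fin.tail y)) = Fin.tail y := hψφ _ hy
    simp [this]
  · intro y hy
    have : φ (ψ (Fin.init y)) = Fin.init y := hφψ _ hy
    simp [this]
  · ext v
    have key : Fin.init v ∈ φ '' (U ∩ A) ↔ Fin.init v ∈ V ∩ {z | ∀ i : Fin d, m ≤ (i : ℕ) → z i = 0} := by
      rw [him]
    constructor
    · rintro ⟨y, ⟨hy, hyA, hy0⟩, rfl⟩
      have := key.1 ⟨Fin.tail y, ⟨hy, hyA⟩, by simp⟩
      refine ⟨this.1, fun i => ?_⟩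
      refine Fin.lastCases ?_ (fun j hj => ?_) i
      · simpa using fun _ => hy0
      · exact this.2 j (by simpa using hj)
    · rintro ⟨hv, hv0⟩
      obtain ⟨y, ⟨hy, hyA⟩, hyv⟩ := key.2 ⟨hv, fun i hi => hv0 i.castSucc (by simpa using hi)⟩
      refine ⟨Fin.cons 0 y, ⟨by simpa using hy, by simpa using hyA, by simp⟩, ?_⟩
      have := hv0 (Fin.last d) (by simpa using hm)
      simp only [Fin.tail_cons, hyv, Fin.cons_zero]
      rw [← this, Fin.snoc_init_self]

end Submanifolds

section FibredSets

open Polynomial Filter Topology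

variable {n : ℕ} {κ : Type} {P : κ → (MvPolynomial (Fin n) ℝ)[X]} {σ : κ → SignType}
  {C : Set (Fin n → ℝ)}

/-- The points over `C` at which the family `P` has signs `σ`. -/
def fibredSet (P : κ → (MvPolynomial (Fin n) ℝ)[X]) (σ : κ → SignType)
    (C : Set (Fin n → ℝ)) : Set (Fin (n + 1) → ℝ) :=
  {w | Fin.tail w ∈ C ∧ w 0 ∈ signFibre P σ (Fin.tail w)}

theorem continuous_eval₂_tail (p : (MvPolynomial (Fin n) ℝ)[X]) :
    Continuous fun w : Fin (n + 1) → ℝ => p.eval₂ (MvPolynomial.eval (Fin.tail w)) (w 0) :=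
  (continuous_eval₂_eval p).comp (continuous_fin_tail.prodMk (continuous_apply 0))

theorem continuous_fin_cons : Continuous fun z : (Fin n → ℝ) × ℝ =>
    (Fin.cons z.2 z.1 : Fin (n + 1) → ℝ) := by
  refine continuous_pi fun i => ?_
  refine Fin.cases ?_ (fun j => ?_) i
  · simpa using continuous_snd
  · simpa [Function.comp_def] using (continuous_apply (A := fun _ => ℝ) j).comp continuous_fst

theorem IsThomFamily.eventually_exists_cons_mem (hP : IsThomFamily P) [Finite κ]
    (hC : ∀ y ∈ C, (signFibre P σ y).Nonempty) {w : Fin (n + 1) → ℝ}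
    (hw : w 0 ∈ weakSignFibre P σ (Fin.tail w)) {U : Set (Fin (n + 1) → ℝ)} (hU : U ∈ 𝓝 w) :
    ∀ᶠ y in 𝓝[C] (Fin.tail w), ∃ s ∈ signFibre P σ y, Fin.cons s y ∈ U := by
  have hU' : (fun z : (Fin n → ℝ) × ℝ => (Fin.cons z.2 z.1 : Fin (n + 1) → ℝ)) ⁻¹' U ∈
      𝓝 (Fin.tail w, w 0) :=
    continuous_fin_cons.continuousAt (by simpa using hU)
  rw [nhds_prod_eq, mem_prod_iff] at hU'
  obtain ⟨N, hN, W, hW, hNW⟩ := hU'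
  filter_upwards [hP.eventually_exists_mem_signFibre hC hw hW, mem_nhdsWithin_of_mem_nhds hN]
    with y ⟨s, hs, hs'⟩ hy
  exact ⟨s, hs', hNW (mk_mem_prod hy hs)⟩

theorem IsThomFamily.mem_closure_fibredSet (hP : IsThomFamily P) [Finite κ]
    (hC : ∀ y ∈ C, (signFibre P σ y).Nonempty) {w : Fin (n + 1) → ℝ}
    (hw : w 0 ∈ weakSignFibre P σ (Fin.tail w)) (hwC : Fin.tail w ∈ closure C) :
    w ∈ closure (fibredSet P σ C) := by
  rw [mem_closure_iff_nhds]
  intro U hU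
  have := mem_closure_iff_nhdsWithin_neBot.1 hwC
  obtain ⟨y, ⟨s, hs, hsU⟩, hy⟩ :=
    ((hP.eventually_exists_cons_mem hC hw hU).and eventually_mem_nhdsWithin).exists
  exact ⟨Fin.cons s y, hsU, by simpa using hy, by simpa using hs⟩

theorem IsThomFamily.isConnected_fibredSet (hP : IsThomFamily P) [Finite κ]
    (hC : ∀ y ∈ C, (signFibre P σ y).Nonempty) (hconn : IsConnected C) :
    IsConnected (fibredSet P σ C) := by
  constructor
  · obtain ⟨y, hy⟩ := hconn.nonempty
    obtain ⟨s, hs⟩ := hC y hy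
    exact ⟨Fin.cons s y, by simpa using hy, by simpa using hs⟩
  rintro U V hU hV hcov ⟨a, ha, haU⟩ ⟨b, hb, hbV⟩
  have fib : ∀ y, IsPreconnected ((fun s => (Fin.cons s y : Fin (n + 1) → ℝ)) '' signFibre P σ y) :=
    fun y => hP.ordConnected_signFibre.isPreconnected.image _
      (continuous_fin_cons.comp (.prodMk_right y)).continuousOn
  have hsub : ∀ y ∈ C, ((fun s => (Fin.cons s y : Fin (n + 1) → ℝ)) '' signFibre P σ y) ⊆
      fibredSet P σ C := by
    rintro y hy _ ⟨s, hs, rfl⟩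
    exact ⟨by simpa using hy, by simpa using hs⟩
  let O : Set (Fin (n + 1) → ℝ) → Set (Fin n → ℝ) := fun U =>
    interior {y | y ∈ C → ∃ s ∈ signFibre P σ y, Fin.cons s y ∈ U}
  have hO : ∀ U, IsOpen U → ∀ w ∈ fibredSet P σ C, w ∈ U → Fin.tail w ∈ O U := by
    intro U hU w hw hwU
    rw [mem_interior_iff_mem_nhds]
    exact eventually_nhdsWithin_iff.1 (hP.eventually_exists_cons_mem hC
      (signFibre_subset_weakSignFibre hw.2) (hU.mem_nhds hwU))
  obtain ⟨y, hy, hyU, hyV⟩ := hconn.isPreconnected (O U) (O V) isOpen_interior isOpen_interior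
    (by
      intro y hy
      obtain ⟨s, hs⟩ := hC y hy
      have hmem := hsub y hy (mem_image_of_mem _ hs)
      rcases hcov hmem with h | h
      · exact Or.inl (by simpa using hO U hU _ hmem h)
      · exact Or.inr (by simpa using hO V hV _ hmem h))
    ⟨Fin.tail a, ha.1, hO U hU a ha haU⟩ ⟨Fin.tail b, hb.1, hO V hV b hb hbV⟩
  obtain ⟨s, hs, hsU⟩ := interior_subset hyU hy
  obtain ⟨t, ht, htV⟩ := interior_subset hyV hy
  obtain ⟨w, hw, hw'⟩ := fib y U V hU hV ((hsub y hy).trans hcov)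
    ⟨_, mem_image_of_mem _ hs, hsU⟩ ⟨_, mem_image_of_mem _ ht, htV⟩
  exact ⟨w, hsub y hy hw, hw'⟩

/-- Over a fixed base, a family without zeros cuts out a submanifold of one more dimension. -/
theorem IsAnalyticSubmanifold.fibredSet_of_forall_ne_zero [Finite κ] {m : ℕ}
    (hC : IsAnalyticSubmanifold C m) (hσ : ∀ k, σ k ≠ 0) :
    IsAnalyticSubmanifold (fibredSet P σ C) (m + 1) := by
  refine hC.cylinder.of_local_diffeo fun z hz => ?_
  have hev : ∀ᶠ w : Fin (n + 1) → ℝ in 𝓝 z, w 0 ∈ signFibre P σ (Fin.tail w) := by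
    refine eventually_all.2 fun k => ?_
    rw [← hz.2 k]
    refine eventually_sign_eq_of_ne_zero (continuous_eval₂_tail (P k)).continuousAt fun h => hσ k ?_
    rw [← hz.2 k, h, sign_zero]
  obtain ⟨U, hU, hUo, hzU⟩ := mem_nhds_iff.1 hev
  exact ⟨id, id, U, U, .id hUo, hzU, fun y hy => ⟨fun h => h.1, fun h => ⟨h, hU hy⟩⟩⟩

theorem IsThomFamily.exists_simple_zero (hP : IsThomFamily P) {x : Fin n → ℝ} {t : ℝ} (k : κ)
    (hk : (P k).eval₂ (MvPolynomial.eval x) t = 0) :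
    ∃ k', (P k').eval₂ (MvPolynomial.eval x) t = 0 ∧
      (Polynomial.derivative (P k')).eval₂ (MvPolynomial.eval x) t ≠ 0 := by
  induction hd : (P k).natDegree using Nat.strong_induction_on generalizing k with
  | _ d ih =>
  by_cases h : (Polynomial.derivative (P k)).eval₂ (MvPolynomial.eval x) t = 0
  · have hd0 : (P k).natDegree ≠ 0 := fun h0 => by
      obtain ⟨a, ha, hl⟩ := hP.leadingCoeff k
      rw [eq_C_of_natDegree_eq_zero h0, eval₂_C, ← h0, coeff_natDegree, hl,
        MvPolynomial.eval_C] at hk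
      exact ha hk
    rcases hP.derivative k with h0 | ⟨k', hk'⟩
    · exact absurd (Polynomial.derivative_eq_zero.1 h0) hd0
    · exact ih _ (by rw [hk', ← hd]; exact natDegree_derivative_lt hd0) k' (by rwa [hk']) rfl
  · exact ⟨k, hk, h⟩

theorem eval_finSuccEquiv_symm (p : (MvPolynomial (Fin n) ℝ)[X]) (w : Fin (n + 1) → ℝ) :
    MvPolynomial.eval w ((MvPolynomial.finSuccEquiv ℝ n).symm p) =
      p.eval₂ (MvPolynomial.eval (Fin.tail w)) (w 0) := by
  conv_lhs => rw [← Fin.cons_self_tail w]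
  rw [MvPolynomial.eval_eq_eval_mv_eval', AlgEquiv.apply_symm_apply, eval₂_eq_eval_map]

theorem analyticOnNhd_eval₂_tail (p : (MvPolynomial (Fin n) ℝ)[X]) :
    AnalyticOnNhd ℝ
      (fun w : Fin (n + 1) → ℝ => p.eval₂ (MvPolynomial.eval (Fin.tail w)) (w 0)) univ := by
  have h : (fun w : Fin (n + 1) → ℝ => p.eval₂ (MvPolynomial.eval (Fin.tail w)) (w 0)) =
      fun w => MvPolynomial.eval w ((MvPolynomial.finSuccEquiv ℝ n).symm p) := by
    ext w
    rw [eval_finSuccEquiv_symm]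
  rw [h]
  exact AnalyticOnNhd.eval_mvPolynomial _

theorem injective_fderiv_cons_eval₂ (p : (MvPolynomial (Fin n) ℝ)[X]) (z : Fin (n + 1) → ℝ)
    (hz : (Polynomial.derivative p).eval₂ (MvPolynomial.eval (Fin.tail z)) (z 0) ≠ 0) :
    Function.Injective (fderiv ℝ (fun w : Fin (n + 1) → ℝ =>
      (Fin.cons (p.eval₂ (MvPolynomial.eval (Fin.tail w)) (w 0)) (Fin.tail w) :
        Fin (n + 1) → ℝ)) z) := by
  set Q : (Fin (n + 1) → ℝ) → ℝ := fun w => p.eval₂ (MvPolynomial.eval (Fin.tail w)) (w 0) with hQ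
  have hQa : AnalyticOnNhd ℝ Q univ := analyticOnNhd_eval₂_tail p
  have hE : DifferentiableAt ℝ
      (fun w : Fin (n + 1) → ℝ => (Fin.cons (Q w) (Fin.tail w) : Fin (n + 1) → ℝ)) z :=
    (hQa.fin_cons (analyticOnNhd_tail _) z (mem_univ z)).differentiableAt
  set F := fderiv ℝ
    (fun w : Fin (n + 1) → ℝ => (Fin.cons (Q w) (Fin.tail w) : Fin (n + 1) → ℝ)) z with hF
  have hcomp := hasFDerivAt_pi'.1 hE.hasFDerivAt
  have htail : ∀ v (i : Fin n), F v i.succ = v i.succ := by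
    intro v i
    have h1 : HasFDerivAt (fun w : Fin (n + 1) → ℝ => w i.succ)
        ((ContinuousLinearMap.proj (R := ℝ) (φ := fun _ : Fin (n + 1) => ℝ) i.succ).comp F) z :=
      hcomp i.succ
    have h2 : HasFDerivAt (fun w : Fin (n + 1) → ℝ => w i.succ)
      (ContinuousLinearMap.proj (R := ℝ) (φ := fun _ : Fin (n + 1) => ℝ) i.succ) z :=
      (ContinuousLinearMap.proj (R := ℝ) (φ := fun _ : Fin (n + 1) => ℝ) i.succ).hasFDerivAt
    exact DFunLike.congr_fun (h1.unique h2) v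
  have hhead : F (Pi.single 0 1) 0 =
      (Polynomial.derivative p).eval₂ (MvPolynomial.eval (Fin.tail z)) (z 0) := by
    have h1 : HasFDerivAt Q
        ((ContinuousLinearMap.proj (R := ℝ) (φ := fun _ : Fin (n + 1) => ℝ) 0).comp F) z :=
      hcomp 0
    have hcurve : HasDerivAt (fun s : ℝ => Function.update z 0 s) (Pi.single 0 1) (z 0) :=
      hasDerivAt_update z 0 (z 0)
    have h2 := HasFDerivAt.comp_hasDerivAt (z 0) (by simpa using h1) hcurve
    have h3 := hasDerivAt_eval₂ p (MvPolynomial.eval (Fin.tail z)) (z 0)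
    have hfun : (Q ∘ fun s => Function.update z 0 s) =
        fun t => p.eval₂ (MvPolynomial.eval (Fin.tail z)) t := by
      ext s
      simp [hQ, Fin.tail_update_zero]
    rw [hfun] at h2
    exact h2.unique h3
  refine (injective_iff_map_eq_zero _).2 fun v hv => ?_
  have hv' : ∀ i : Fin n, v i.succ = 0 := fun i => by rw [← htail v i, hv, Pi.zero_apply]
  have hvs : v = v 0 • Pi.single 0 1 := by
    ext i
    refine Fin.cases ?_ (fun j => ?_) i
    · simp
    · simp [hv']
  have h0 : v 0 * F (Pi.single 0 1) 0 = 0 := by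
    have : F v 0 = 0 := by rw [hv, Pi.zero_apply]
    rw [hvs, map_smul] at this
    simpa using this
  rw [hhead] at h0
  rw [hvs, (mul_eq_zero.1 h0).resolve_right hz, zero_smul]

/-- Over a fixed base, a family with a zero cuts out a graph, of the same dimension. -/
theorem IsThomFamily.isAnalyticSubmanifold_fibredSet (hP : IsThomFamily P) [Finite κ] {m : ℕ}
    (hm : m ≤ n) (hCm : IsAnalyticSubmanifold C m) (hC : ∀ y ∈ C, (signFibre P σ y).Nonempty)
    {k : κ} (hσ : σ k = 0) : IsAnalyticSubmanifold (fibredSet P σ C) m := by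
  refine (hCm.hyperplane hm).of_local_diffeo fun z hz => ?_
  obtain ⟨l, hl, hl'⟩ := hP.exists_simple_zero k (x := Fin.tail z) (t := z 0)
    (sign_eq_zero_iff.1 ((hz.2 k).trans hσ))
  have hσl : σ l = 0 := by rw [← hz.2 l, hl, sign_zero]
  have hinj := injective_fderiv_cons_eval₂ (P l) z hl'
  have hE := (analyticOnNhd_eval₂_tail (P l)).fin_cons (analyticOnNhd_tail univ)
  obtain ⟨E₀, U₀, V₀, hE₀, hzU₀, -⟩ := exists_isAnalyticDiffeoOn hE hinj univ_mem
  have hN : {y | y ∈ C → ∃ s ∈ signFibre P σ y, Fin.cons s y ∈ U₀} ∈ 𝓝 (Fin.tail z) :=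
    eventually_nhdsWithin_iff.1 (hP.eventually_exists_cons_mem hC
      (signFibre_subset_weakSignFibre hz.2) (hE₀.isOpen_source.mem_nhds hzU₀))
  obtain ⟨E', U, V, hEU, hzU, hUN⟩ := exists_isAnalyticDiffeoOn hE hinj
    (inter_mem (hE₀.isOpen_source.mem_nhds hzU₀) (continuous_fin_tail.continuousAt hN))
  refine ⟨_, E', U, V, hEU, hzU, fun w hw => ?_⟩
  simp only [Set.mem_ofPred_eq, Fin.tail_cons, Fin.cons_zero]
  constructor
  · rintro ⟨h1, h2⟩
    exact ⟨h1, sign_eq_zero_iff.1 ((h2 l).trans hσl)⟩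
  · rintro ⟨h1, h2⟩
    obtain ⟨hw0, hw1⟩ := hUN hw
    obtain ⟨s, hs, hsU⟩ := hw1 h1
    have : w = Fin.cons s (Fin.tail w) := by
      refine (hE₀.left_inv w hw0).symm.trans (Eq.trans ?_ (hE₀.left_inv _ hsU))
      have h3 : (P l).eval₂ (MvPolynomial.eval (Fin.tail w)) s = 0 :=
        sign_eq_zero_iff.1 ((hs l).trans hσl)
      simp [h2, h3]
    refine ⟨h1, ?_⟩
    rw [this]
    simpa using hs

end FibredSets

section SignCells

open Filter Topology

/-- The set of points at which the polynomials `G i` have the same signs as at `x`. -/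
def signCell {n : ℕ} {ι : Type} (G : ι → MvPolynomial (Fin n) ℝ) (x : Fin n → ℝ) :
    Set (Fin n → ℝ) :=
  {y | ∀ i, SignType.sign (MvPolynomial.eval y (G i)) = SignType.sign (MvPolynomial.eval x (G i))}

/-- The sign cells of `G` form a stratification of `ℝⁿ`, the cell of `x` having dimension `dim x`;
moreover the closure of a cell is obtained by relaxing the strict sign conditions. -/
structure IsSignStratification {n : ℕ} {ι : Type} (G : ι → MvPolynomial (Fin n) ℝ)
    (dim : (Fin n → ℝ) → ℕ) : Prop where
  dim_le : ∀ x, dim x ≤ n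
  dim_eq : ∀ x, ∀ y ∈ signCell G x, dim y = dim x
  isConnected : ∀ x, IsConnected (signCell G x)
  isAnalyticSubmanifold : ∀ x, IsAnalyticSubmanifold (signCell G x) (dim x)
  mem_closure : ∀ x y, (∀ i, SignType.sign (MvPolynomial.eval y (G i)) =
    SignType.sign (MvPolynomial.eval x (G i)) ∨ MvPolynomial.eval y (G i) = 0) →
    y ∈ closure (signCell G x)
  dim_lt : ∀ x, ∀ y ∈ closure (signCell G x), y ∈ signCell G x ∨ dim y < dim x

theorem mem_signCell_self {n : ℕ} {ι : Type} (G : ι → MvPolynomial (Fin n) ℝ) (x : Fin n → ℝ) :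
    x ∈ signCell G x := fun _ => rfl

theorem isClosed_sign_eq_or_eq_zero {X : Type*} [TopologicalSpace X] {f : X → ℝ}
    (hf : Continuous f) (s : SignType) : IsClosed {y | SignType.sign (f y) = s ∨ f y = 0} := by
  simp only [sign_eq_or_eq_zero_iff]
  cases s
  · simpa using isClosed_eq hf continuous_const
  · simpa using isClosed_le hf continuous_const
  · simpa using isClosed_le continuous_const hf

theorem sign_eq_or_eq_zero_of_mem_closure {n : ℕ} {ι : Type} {G : ι → MvPolynomial (Fin n) ℝ}
    {x y : Fin n → ℝ} (hy : y ∈ closure (signCell G x)) (i : ι) :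
    SignType.sign (MvPolynomial.eval y (G i)) = SignType.sign (MvPolynomial.eval x (G i)) ∨
      MvPolynomial.eval y (G i) = 0 := by
  have hcl := isClosed_sign_eq_or_eq_zero (MvPolynomial.continuous_eval (G i))
    (SignType.sign (MvPolynomial.eval x (G i)))
  exact closure_minimal (s := signCell G x) (fun z hz => Or.inl (hz i)) hcl hy

open Polynomial

theorem eval_rename_succ {n : ℕ} (g : MvPolynomial (Fin n) ℝ) (w : Fin (n + 1) → ℝ) :
    MvPolynomial.eval w (MvPolynomial.rename Fin.succ g) = MvPolynomial.eval (Fin.tail w) g := by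
  rw [MvPolynomial.eval_rename]
  rfl

/-- Polynomials in the first variable together with polynomials in the other variables. -/
noncomputable def liftFamily {n : ℕ} {κ ι : Type} (P : κ → (MvPolynomial (Fin n) ℝ)[X])
    (G : ι → MvPolynomial (Fin n) ℝ) : κ ⊕ ι → MvPolynomial (Fin (n + 1)) ℝ :=
  Sum.elim (fun k => (MvPolynomial.finSuccEquiv ℝ n).symm (P k))
    (fun i => MvPolynomial.rename Fin.succ (G i))

theorem signCell_liftFamily {n : ℕ} {κ ι : Type} (P : κ → (MvPolynomial (Fin n) ℝ)[X])
    (G : ι → MvPolynomial (Fin n) ℝ) (z : Fin (n + 1) → ℝ) : signCell (liftFamily P G) z =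
      fibredSet P (fun k => SignType.sign ((P k).eval₂ (MvPolynomial.eval (Fin.tail z)) (z 0)))
        (signCell G (Fin.tail z)) := by
  ext w
  simp [signCell, liftFamily, fibredSet, signFibre, eval_rename_succ, eval_finSuccEquiv_symm,
    and_comm]

open Classical in
/-- Lifting of a stratification of `ℝⁿ` to `ℝⁿ⁺¹`. -/
theorem IsSignStratification.lift {n : ℕ} {κ ι : Type} [Finite κ]
    {P : κ → (MvPolynomial (Fin n) ℝ)[X]} {G : ι → MvPolynomial (Fin n) ℝ}
    {dim : (Fin n → ℝ) → ℕ} (hG : IsSignStratification G dim) (hP : IsThomFamily P)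
    (hdet : ∀ x, ∀ y ∈ signCell G x, ∀ t, ∃ t', ∀ k,
      SignType.sign ((P k).eval₂ (MvPolynomial.eval x) t) =
        SignType.sign ((P k).eval₂ (MvPolynomial.eval y) t')) :
    IsSignStratification (liftFamily P G) fun z => dim (Fin.tail z) +
      if ∃ k, (P k).eval₂ (MvPolynomial.eval (Fin.tail z)) (z 0) = 0 then 0 else 1 := by
  have hne : ∀ z : Fin (n + 1) → ℝ, ∀ y ∈ signCell G (Fin.tail z), (signFibre P (fun k =>
      SignType.sign ((P k).eval₂ (MvPolynomial.eval (Fin.tail z)) (z 0))) y).Nonempty := by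
    intro z y hy
    obtain ⟨t', ht'⟩ := hdet _ y hy (z 0)
    exact ⟨t', fun k => (ht' k).symm⟩
  constructor
  · intro z
    have := hG.dim_le (Fin.tail z)
    split_ifs <;> omega
  · intro z w hw
    rw [signCell_liftFamily] at hw
    rw [hG.dim_eq _ _ hw.1]
    congr 1
    refine if_congr (exists_congr fun k => ?_) rfl rfl
    rw [← sign_eq_zero_iff, hw.2 k, sign_eq_zero_iff]
  · intro z
    rw [signCell_liftFamily]
    exact hP.isConnected_fibredSet (hne z) (hG.isConnected _)
  · intro z
    rw [signCell_liftFamily]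
    split_ifs with h
    · obtain ⟨k, hk⟩ := h
      exact hP.isAnalyticSubmanifold_fibredSet (hG.dim_le _) (hG.isAnalyticSubmanifold _) (hne z)
        (k := k) (by rw [hk, sign_zero])
    · push Not at h
      exact (hG.isAnalyticSubmanifold _).fibredSet_of_forall_ne_zero fun k =>
        by simpa using h k
  · intro z w hw
    rw [signCell_liftFamily]
    simp only [liftFamily, Sum.forall, Sum.elim_inl, Sum.elim_inr, eval_finSuccEquiv_symm,
      eval_rename_succ] at hw
    exact hP.mem_closure_fibredSet (hne z) hw.1 (hG.mem_closure _ _ hw.2)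
  · intro z w hw
    have hw1 : w 0 ∈ weakSignFibre P (fun k =>
        SignType.sign ((P k).eval₂ (MvPolynomial.eval (Fin.tail z)) (z 0))) (Fin.tail w) := by
      intro k
      have := sign_eq_or_eq_zero_of_mem_closure hw (Sum.inl k)
      simpa only [liftFamily, Sum.elim_inl, eval_finSuccEquiv_symm] using this
    have hw2 : Fin.tail w ∈ closure (signCell G (Fin.tail z)) := by
      refine closure_mono ?_ (image_closure_subset_closure_image continuous_fin_tail
        (mem_image_of_mem _ hw))
      rintro _ ⟨v, hv, rfl⟩
      rw [signCell_liftFamily] at hv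
      exact hv.1
    rw [signCell_liftFamily]
    rcases hG.dim_lt _ _ hw2 with h | h
    · rw [hG.dim_eq _ _ h]
      obtain ⟨s, hs⟩ := hne z _ h
      by_cases hz : ∃ k, (P k).eval₂ (MvPolynomial.eval (Fin.tail z)) (z 0) = 0
      · left
        refine ⟨h, ?_⟩
        suffices w 0 = s by rwa [this]
        obtain ⟨k, hk⟩ := hz
        by_contra hne'
        have hsub := hP.ordConnected_weakSignFibre.uIcc_subset hw1
          (signFibre_subset_weakSignFibre hs)
        refine (hP.finite_roots (Fin.tail w)).not_infinite
          (Set.Infinite.mono (s := uIcc (w 0) s) (fun t ht => ⟨k, ?_⟩) ?_)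
        · have := hsub ht k
          simpa [hk] using this
        · rw [uIcc]
          exact Icc_infinite (inf_lt_sup.2 hne')
      · by_cases hw0 : ∃ k, (P k).eval₂ (MvPolynomial.eval (Fin.tail w)) (w 0) = 0
        · right
          simp [hz, hw0]
        · left
          push Not at hw0
          exact ⟨h, fun k => (hw1 k).resolve_right (hw0 k)⟩
    · right
      by_cases hz : ∃ k, (P k).eval₂ (MvPolynomial.eval (Fin.tail z)) (z 0) = 0
      · have : ∃ k, (P k).eval₂ (MvPolynomial.eval (Fin.tail w)) (w 0) = 0 := by
          obtain ⟨k, hk⟩ := hz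
          refine ⟨k, ?_⟩
          have := hw1 k
          simpa [hk] using this
        simpa [hz, this] using h
      · rw [if_neg hz]
        split_ifs <;> omega

theorem analyticOnNhd_shearMap {n : ℕ} (u : ℕ) (c : ℝ) (s : Set (Fin (n + 1) → ℝ)) :
    AnalyticOnNhd ℝ (shearMap u c) s := by
  refine AnalyticOnNhd.pi fun i => ?_
  by_cases h : i = 0
  · simpa [shearMap, h] using analyticOnNhd_apply 0 s
  · simp only [shearMap, h, if_false]
    exact (analyticOnNhd_apply i s).add (analyticOnNhd_const.mul ((analyticOnNhd_apply 0 s).pow _))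

/-- `shearMap` as a homeomorphism. -/
def shearHomeomorph {n : ℕ} (u : ℕ) (c : ℝ) : (Fin (n + 1) → ℝ) ≃ₜ (Fin (n + 1) → ℝ) where
  toFun := shearMap u c
  invFun := shearMap u (-c)
  left_inv := shearMap_neg_shearMap u c
  right_inv := shearMap_shearMap_neg u c
  continuous_toFun := continuousOn_univ.1 (analyticOnNhd_shearMap u c univ).continuousOn
  continuous_invFun := continuousOn_univ.1 (analyticOnNhd_shearMap u (-c) univ).continuousOn

theorem signCell_shear {n : ℕ} {ι : Type} (G : ι → MvPolynomial (Fin (n + 1)) ℝ) (u : ℕ) (c : ℝ)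
    (x : Fin (n + 1) → ℝ) : signCell (fun i => shear u c (G i)) x =
      shearHomeomorph u c ⁻¹' signCell G (shearMap u c x) := by
  ext y
  simp [signCell, eval_shear, shearHomeomorph]

/-- Stratifications can be pulled back along shears. -/
theorem IsSignStratification.shear {n : ℕ} {ι : Type} {G : ι → MvPolynomial (Fin (n + 1)) ℝ}
    {dim : (Fin (n + 1) → ℝ) → ℕ} (hG : IsSignStratification G dim) (u : ℕ) (c : ℝ) :
    IsSignStratification (fun i => shear u c (G i)) fun x => dim (shearMap u c x) := by
  constructor
  · exact fun x => hG.dim_le _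
  · intro x y hy
    rw [signCell_shear] at hy
    exact hG.dim_eq _ _ hy
  · intro x
    rw [signCell_shear, Homeomorph.isConnected_preimage]
    exact hG.isConnected _
  · intro x
    refine (hG.isAnalyticSubmanifold (shearMap u c x)).of_local_diffeo fun z hz =>
      ⟨shearMap u c, shearMap u (-c), univ, univ, ⟨isOpen_univ, isOpen_univ,
        analyticOnNhd_shearMap _ _ _, analyticOnNhd_shearMap _ _ _, fun _ _ => mem_univ _,
        fun _ _ => mem_univ _, fun y _ => shearMap_neg_shearMap u c y,
        fun y _ => shearMap_shearMap_neg u c y⟩, mem_univ _, fun y _ => ?_⟩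
    rw [signCell_shear]
    rfl
  · intro x y hy
    rw [signCell_shear, ← Homeomorph.preimage_closure]
    refine hG.mem_closure _ _ fun i => ?_
    have := hy i
    simp only [eval_shear] at this
    exact this
  · intro x y hy
    rw [signCell_shear, ← Homeomorph.preimage_closure] at hy
    rw [signCell_shear]
    exact hG.dim_lt _ _ hy

end SignCells

section Stratification

open Polynomial

theorem exists_leadingCoeff_iterate_derivative {n : ℕ} {p : (MvPolynomial (Fin n) ℝ)[X]}
    (hp : ∃ a : ℝ, a ≠ 0 ∧ p.leadingCoeff = MvPolynomial.C a) (k : ℕ)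
    (hk : derivative^[k] p ≠ 0) :
    ∃ a : ℝ, a ≠ 0 ∧ (derivative^[k] p).leadingCoeff = MvPolynomial.C a := by
  induction k with
  | zero => exact hp
  | succ k ih =>
    rw [Function.iterate_succ_apply'] at hk ⊢
    obtain ⟨a, -, h⟩ := ih fun h0 => hk (by rw [h0, map_zero])
    have hlead : (derivative (derivative^[k] p)).leadingCoeff =
        MvPolynomial.C (a * ((derivative^[k] p).natDegree : ℝ)) := by
      rw [leadingCoeff_derivative, h, map_mul, map_natCast]
    refine ⟨_, fun h0 => hk ?_, hlead⟩
    rwa [h0, map_zero, leadingCoeff_eq_zero] at hlead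

theorem totalDegree_coeff_iterate_derivative_finSuccEquiv_le {n : ℕ}
    (f : MvPolynomial (Fin (n + 1)) ℝ) (k i : ℕ) :
    ((derivative^[k] (MvPolynomial.finSuccEquiv ℝ n f)).coeff i).totalDegree ≤ f.totalDegree := by
  rw [coeff_iterate_derivative]
  refine (MvPolynomial.totalDegree_smul_le _ _).trans ?_
  by_cases h : (MvPolynomial.finSuccEquiv ℝ n f).coeff (i + k) = 0
  · simp [h]
  · exact (Nat.le_add_right _ _).trans (MvPolynomial.totalDegree_coeff_finSuccEquiv_add_le f _ h)

theorem natDegree_finSuccEquiv_le {n : ℕ} (f : MvPolynomial (Fin (n + 1)) ℝ) :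
    (MvPolynomial.finSuccEquiv ℝ n f).natDegree ≤ f.totalDegree := by
  rw [MvPolynomial.natDegree_finSuccEquiv]
  exact MvPolynomial.degreeOf_le_totalDegree f 0

theorem isSignStratification_zero {ι : Type} (G : ι → MvPolynomial (Fin 0) ℝ) :
    IsSignStratification G fun _ => 0 := by
  have hcell : ∀ x, signCell G x = univ := fun x =>
    eq_univ_of_forall fun y => Subsingleton.elim x y ▸ mem_signCell_self G x
  refine ⟨fun _ => le_rfl, fun _ _ _ => rfl, fun x => ?_, fun x => ?_, fun x y _ => ?_,
    fun x y _ => ?_⟩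
  · rw [hcell]
    exact isConnected_univ
  · intro y _
    refine ⟨univ, univ, id, id, isOpen_univ, isOpen_univ, mem_univ _, analyticOnNhd_id,
      analyticOnNhd_id, fun _ _ => mem_univ _, fun _ _ => mem_univ _, fun _ _ => rfl,
      fun _ _ => rfl, ?_⟩
    rw [hcell, image_id]
    simp
  · rw [hcell]
    exact subset_closure (mem_univ y)
  · rw [hcell]
    exact Or.inl (mem_univ y)

/-- Any finite family of polynomials can be refined to one whose sign cells form a stratification,
with uniform bounds. -/
theorem exists_isSignStratification (n : ℕ) : ∀ s d : ℕ, ∃ M : ℕ,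
    ∀ F : Finset (MvPolynomial (Fin n) ℝ), F.card ≤ s → (∀ f ∈ F, f.totalDegree ≤ d) →
      ∃ (ι : Type) (_ : Fintype ι) (G : ι → MvPolynomial (Fin n) ℝ) (dim : (Fin n → ℝ) → ℕ),
        Fintype.card ι ≤ M ∧
        (∀ x, ∀ y ∈ signCell G x, ∀ f ∈ F,
          SignType.sign (MvPolynomial.eval y f) = SignType.sign (MvPolynomial.eval x f)) ∧
        IsSignStratification G dim := by
  classical
  induction n with
  | zero =>
    refine fun s d => ⟨0, fun F _ _ => ⟨Empty, inferInstance, Empty.elim, fun _ => 0, by simp,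
      fun x y _ f _ => ?_, isSignStratification_zero _⟩⟩
    rw [Subsingleton.elim x y]
  | succ n ih =>
    intro s d
    set u := d + 2 with hu
    set e := d * (1 + u ^ n) with he
    obtain ⟨K, D, hKD⟩ := exists_uniform_sign_determined (s * (e + 1)) e
    obtain ⟨M, hM⟩ := ih K D
    refine ⟨s * (e + 1) + M, fun F hFs hFd => ?_⟩
    set p : MvPolynomial (Fin (n + 1)) ℝ → (MvPolynomial (Fin n) ℝ)[X] :=
      fun f => MvPolynomial.finSuccEquiv ℝ n (shear u 1 f) with hp
    have hdeg : ∀ f ∈ F, (shear u 1 f).totalDegree ≤ e := fun f hf =>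
      (totalDegree_shear_le (by omega) 1 f).trans (Nat.mul_le_mul_right _ (hFd f hf))
    have hpdeg : ∀ f ∈ F, (p f).natDegree ≤ e := fun f hf =>
      (natDegree_finSuccEquiv_le _).trans (hdeg f hf)
    let κ : Type := {q : F × Fin (e + 1) // derivative^[q.2] (p q.1) ≠ 0}
    let P : κ → (MvPolynomial (Fin n) ℝ)[X] := fun q => derivative^[q.1.2] (p q.1.1)
    have hκ : Fintype.card κ ≤ s * (e + 1) := by
      refine (Fintype.card_subtype_le _).trans ?_
      rw [Fintype.card_prod, Fintype.card_coe, Fintype.card_fin]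
      exact Nat.mul_le_mul_right _ hFs
    have hthom : IsThomFamily P := by
      refine ⟨fun q => exists_leadingCoeff_iterate_derivative ?_ _ q.2, fun q => ?_⟩
      · refine leadingCoeff_shear (by omega) _ (fun h0 => q.2 ?_)
          ((hFd _ q.1.1.2).trans_lt (by omega))
        simp [hp, h0]
      · refine or_iff_not_imp_left.2 fun h0 => ?_
        have h1 : derivative^[(q.1.2 : ℕ) + 1] (p q.1.1) ≠ 0 := by
          rwa [Function.iterate_succ_apply']
        have h2 : (q.1.2 : ℕ) + 1 < e + 1 := by
          by_contra hlt
          exact h1 (iterate_derivative_eq_zero ((hpdeg _ q.1.1.2).trans_lt (by omega)))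
        exact ⟨⟨(q.1.1, ⟨_, h2⟩), h1⟩, Function.iterate_succ_apply' _ _ _⟩
    obtain ⟨H, hHK, hHD, hH⟩ := hKD n κ P hκ
      (fun q => (natDegree_iterate_derivative _ _).trans
        ((Nat.sub_le _ _).trans (hpdeg _ q.1.1.2)))
      (fun q i => (totalDegree_coeff_iterate_derivative_finSuccEquiv_le _ _ _).trans
        (hdeg _ q.1.1.2))
    obtain ⟨ι, _, G, dim, hι, hGH, hG⟩ := hM H hHK hHD
    have hlift := (hG.lift hthom fun x y hy t => hH x y (fun h hh => (hGH x y hy h hh).symm) t).shear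
      u (-1)
    refine ⟨κ ⊕ ι, inferInstance, _, _, ?_, fun x y hy f hf => ?_, hlift⟩
    · rw [Fintype.card_sum]
      omega
    · by_cases h0 : p f = 0
      · have hf0 : shear u 1 f = 0 := by simpa [hp] using h0
        have heval : ∀ z, MvPolynomial.eval z f = 0 := fun z => by
          rw [← shearMap_shearMap_neg u 1 z, ← eval_shear, hf0, map_zero]
        rw [heval, heval]
      · have := hy (Sum.inl ⟨(⟨f, hf⟩, 0), h0⟩)
        simpa only [liftFamily, Sum.elim_inl, P, hp, Fin.val_zero, Function.iterate_zero_apply,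
          AlgEquiv.symm_apply_apply, eval_shear, shearMap_shearMap_neg] using this

/-- The polynomials of positive degree occurring in a presentation. -/
noncomputable def SAPres.polys {n : ℕ} (p : SAPres n) : List (MvPolynomial (Fin n) ℝ) :=
  (p.flatMap fun c => c.1 ++ c.2).filter fun f => 0 < f.totalDegree

theorem SAPres.sum_totalDegree {n : ℕ} (p : SAPres n) :
    ((p.flatMap fun c => c.1 ++ c.2).map MvPolynomial.totalDegree).sum = p.deg := by
  induction p with
  | nil => rfl
  | cons c p ih =>
    rw [List.flatMap_cons, List.map_append, List.sum_append, ih]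
    simp [SAPres.deg]

theorem length_filter_pos_le_sum {α : Type*} (l : List α) (g : α → ℕ) :
    (l.filter fun a => 0 < g a).length ≤ (l.map g).sum := by
  induction l with
  | nil => rfl
  | cons a l ih =>
    rw [List.filter_cons, List.map_cons, List.sum_cons]
    split_ifs with h
    · rw [decide_eq_true_eq] at h
      rw [List.length_cons]
      omega
    · omega

theorem SAPres.length_polys_le {n : ℕ} (p : SAPres n) : p.polys.length ≤ p.deg := by
  rw [← p.sum_totalDegree]
  exact length_filter_pos_le_sum _ _

theorem SAPres.totalDegree_le_of_mem_polys {n : ℕ} {p : SAPres n} {f : MvPolynomial (Fin n) ℝ}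
    (hf : f ∈ p.polys) : f.totalDegree ≤ p.deg := by
  rw [← p.sum_totalDegree]
  exact List.single_le_sum (fun _ _ => Nat.zero_le _) _
    (List.mem_map_of_mem (List.mem_of_mem_filter hf))

theorem SAPres.mem_toSet_of_sign_eq {n : ℕ} {p : SAPres n} {x y : Fin n → ℝ}
    (h : ∀ f ∈ p.polys,
      SignType.sign (MvPolynomial.eval y f) = SignType.sign (MvPolynomial.eval x f))
    (hx : x ∈ p.toSet) : y ∈ p.toSet := by
  have key : ∀ c ∈ p, ∀ f ∈ c.1 ++ c.2,
      SignType.sign (MvPolynomial.eval y f) = SignType.sign (MvPolynomial.eval x f) := by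
    intro c hc f hf
    rcases Nat.eq_zero_or_pos f.totalDegree with h0 | h0
    · rw [MvPolynomial.totalDegree_eq_zero_iff_eq_C.1 h0, MvPolynomial.eval_C, MvPolynomial.eval_C]
    · exact h f (List.mem_filter.2 ⟨List.mem_flatMap.2 ⟨c, hc, hf⟩, by simpa using h0⟩)
  obtain ⟨c, hc, h1, h2⟩ := hx
  refine ⟨c, hc, fun f hf => ?_, fun f hf => ?_⟩
  · rw [← sign_eq_one_iff, key c hc f (List.mem_append_left _ hf), sign_eq_one_iff]
    exact h1 f hf
  · rw [← sign_eq_zero_iff, key c hc f (List.mem_append_right _ hf), sign_eq_zero_iff]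
    exact h2 f hf

theorem SAPres.exists_toSet_singleton_inter {n : ℕ} {A B : Set (Fin n → ℝ)}
    (hA : ∃ c : List (MvPolynomial (Fin n) ℝ) × List (MvPolynomial (Fin n) ℝ), SAPres.toSet [c] = A)
    (hB : ∃ c : List (MvPolynomial (Fin n) ℝ) × List (MvPolynomial (Fin n) ℝ), SAPres.toSet [c] = B) :
    ∃ c : List (MvPolynomial (Fin n) ℝ) × List (MvPolynomial (Fin n) ℝ),
      SAPres.toSet [c] = A ∩ B := by
  obtain ⟨a, rfl⟩ := hA
  obtain ⟨b, rfl⟩ := hB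
  refine ⟨(a.1 ++ b.1, a.2 ++ b.2), ?_⟩
  ext x
  simp only [SAPres.toSet, List.mem_singleton, exists_eq_left, mem_ofPred_eq, mem_inter_iff,
    List.forall_mem_append]
  tauto

theorem isSemialgebraic_signCell {n : ℕ} {ι : Type} [Fintype ι] (G : ι → MvPolynomial (Fin n) ℝ)
    (x : Fin n → ℝ) : IsSemialgebraic (signCell G x) := by
  classical
  have key : ∀ t : Finset ι,
      ∃ c : List (MvPolynomial (Fin n) ℝ) × List (MvPolynomial (Fin n) ℝ), SAPres.toSet [c] =
        {y | ∀ i ∈ t, SignType.sign (MvPolynomial.eval y (G i)) =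
          SignType.sign (MvPolynomial.eval x (G i))} := by
    intro t
    induction t using Finset.induction_on with
    | empty => exact ⟨([], []), by simp [SAPres.toSet]⟩
    | insert i t _ ih =>
      simp only [Finset.forall_mem_insert, ofPred_and]
      refine SAPres.exists_toSet_singleton_inter ?_ ih
      rcases h : SignType.sign (MvPolynomial.eval x (G i)) with _ | _ | _
      · exact ⟨([], [G i]), by ext y; simp [SAPres.toSet]⟩
      · exact ⟨([-G i], []), by ext y; simpa [SAPres.toSet] using sign_eq_neg_one_iff.symm⟩
      · exact ⟨([G i], []), by ext y; simpa [SAPres.toSet] using sign_eq_one_iff.symm⟩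
  obtain ⟨c, hc⟩ := key Finset.univ
  exact ⟨[c], by simpa [signCell] using hc⟩

theorem signCell_eq_of_mem {n : ℕ} {ι : Type} {G : ι → MvPolynomial (Fin n) ℝ}
    {x y : Fin n → ℝ} (hy : y ∈ signCell G x) : signCell G y = signCell G x := by
  ext z
  exact forall_congr' fun i => by rw [hy i]

/-- There are at most `3 ^ card ι` sign cells, so they can be indexed by representatives. -/
theorem exists_signCell_representatives {n : ℕ} {ι : Type} [Fintype ι]
    (G : ι → MvPolynomial (Fin n) ℝ) (A : Set (Fin n → ℝ)) :
    ∃ (N : ℕ) (x : Fin N → Fin n → ℝ), N ≤ 3 ^ Fintype.card ι ∧ (∀ i, x i ∈ A) ∧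
      (∀ y ∈ A, ∃ i, y ∈ signCell G (x i)) ∧ ∀ i j, x i ∈ signCell G (x j) → i = j := by
  classical
  let σ : (Fin n → ℝ) → ι → SignType := fun x i => SignType.sign (MvPolynomial.eval x (G i))
  let T : Type := {τ : ι → SignType // τ ∈ σ '' A}
  let e : T ≃ Fin (Fintype.card T) := Fintype.equivFin T
  choose r hrA hr using fun τ : T => τ.2
  refine ⟨Fintype.card T, fun i => r (e.symm i), ?_, fun i => hrA _, fun y hy => ?_, ?_⟩
  · refine (Fintype.card_subtype_le _).trans ?_
    rw [Fintype.card_fun]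
    rfl
  · refine ⟨e ⟨σ y, mem_image_of_mem _ hy⟩, fun i => ?_⟩
    have := congrFun (hr ⟨σ y, mem_image_of_mem _ hy⟩) i
    simpa only [Equiv.symm_apply_apply] using this.symm
  · intro i j h
    apply e.symm.injective
    rw [Subtype.ext_iff, ← hr, ← hr]
    exact funext h

end Stratification

/-- **Stratification.** Every semi-algebraic set `A ⊆ ℝ^n` is a disjoint union of `N`
connected Nash manifolds, `N` bounded in terms of `deg A` and `n`, satisfying the frontier
condition: if `i ≠ j` and `Aᵢ` meets `closure Aⱼ` then `Aᵢ ⊆ closure Aⱼ` and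
`dim Aᵢ < dim Aⱼ`. -/
theorem stratification :
    ∃ C : ℕ → ℕ → ℕ, ∀ (n : ℕ) (A : Set (Fin n → ℝ)), IsSemialgebraic A →
      ∃ (N : ℕ) (S : Fin N → Set (Fin n → ℝ)) (m : Fin N → ℕ),
        N ≤ C (SADeg A) n ∧
        (∀ i, IsNashManifold (S i) (m i)) ∧
        (∀ i, IsConnected (S i)) ∧
        A = (⋃ i, S i) ∧
        (∀ i j, i ≠ j → Disjoint (S i) (S j)) ∧
        (∀ i j, i ≠ j → (S i ∩ closure (S j)).Nonempty →
          S i ⊆ closure (S j) ∧ m i < m j) := by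
  classical
  choose M hM using exists_isSignStratification
  refine ⟨fun D n => 3 ^ M n D D, fun n A hA => ?_⟩
  obtain ⟨p, hpA, hpD⟩ : SADeg A ∈ SAPres.deg '' {p : SAPres n | p.toSet = A} :=
    Nat.sInf_mem (hA.elim fun p hp => ⟨_, p, hp, rfl⟩)
  obtain ⟨ι, _, G, dim, hι, hGF, hG⟩ := hM n (SADeg A) (SADeg A) p.polys.toFinset
    ((List.toFinset_card_le _).trans (hpD ▸ p.length_polys_le))
    fun f hf => hpD ▸ SAPres.totalDegree_le_of_mem_polys (List.mem_toFinset.1 hf)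
  have hAcell : ∀ x ∈ A, signCell G x ⊆ A := by
    intro x hx y hy
    rw [← hpA] at hx ⊢
    exact SAPres.mem_toSet_of_sign_eq (fun f hf => hGF x y hy f (List.mem_toFinset.2 hf)) hx
  obtain ⟨N, x, hN, hxA, hcover, hinj⟩ := exists_signCell_representatives G A
  refine ⟨N, fun i => signCell G (x i), fun i => dim (x i),
    hN.trans (Nat.pow_le_pow_right (by norm_num) hι),
    fun i => ⟨isSemialgebraic_signCell G _, hG.isAnalyticSubmanifold _⟩,
    fun i => hG.isConnected _, ?_, fun i j hij => ?_, fun i j hij => ?_⟩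
  · refine Subset.antisymm (fun y hy => mem_iUnion.2 (hcover y hy))
      (iUnion_subset fun i => hAcell _ (hxA i))
  · refine disjoint_left.2 fun y hi hj => hij (hinj i j ?_)
    rw [← signCell_eq_of_mem hj, signCell_eq_of_mem hi]
    exact mem_signCell_self G _
  · rintro ⟨y, hyi, hyj⟩
    refine ⟨fun z hz => hG.mem_closure _ _ fun k => ?_, ?_⟩
    · have hzy := (hz k).trans (hyi k).symm
      rw [← sign_eq_zero_iff, hzy, sign_eq_zero_iff]
      exact sign_eq_or_eq_zero_of_mem_closure hyj k
    · show dim (x i) < dim (x j)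
      rw [← hG.dim_eq _ _ hyi]
      refine (hG.dim_lt _ _ hyj).resolve_left fun h => hij (hinj i j ?_)
      rw [← signCell_eq_of_mem h, signCell_eq_of_mem hyi]
      exact mem_signCell_self G _
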